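/- A finite-dimensional cube complex is non-positively curved (locally CAT(0)) if and only if the link of every vertex is a flag simplicial complex (Gromov's Link Condition). -/

import Mathlib

noncomputable section

/-! ### CAT(0) geometry -/

/-- A geodesic from `x` to `y`, parametrised by arclength on `[0, dist x y]`. -/
def IsGeodesicFrom {X : Type*} [MetricSpace X] (γ : ℝ → X) (x y : X) : Prop :=
  γ 0 = x ∧ γ (dist x y) = y ∧
    ∀ s ∈ Set.Icc (0 : ℝ) (dist x y), ∀ t ∈ Set.Icc (0 : ℝ) (dist x y),
      dist (γ s) (γ t) = |s - t|

/-- A geodesic metric space: any two points are joined by a geodesic. -/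
def GeodesicSpace (X : Type*) [MetricSpace X] : Prop :=
  ∀ x y : X, ∃ γ : ℝ → X, IsGeodesicFrom γ x y

/-- `m` is a midpoint of `x` and `y`. -/
def IsMidpoint {X : Type*} [MetricSpace X] (m x y : X) : Prop :=
  dist x m = dist x y / 2 ∧ dist y m = dist x y / 2

/-- A CAT(0) space: a geodesic space satisfying the CN inequality of
Bruhat–Tits, which for geodesic spaces is equivalent to the comparison-triangle
definition of CAT(0). -/
def CAT0 (X : Type*) [MetricSpace X] : Prop :=
  GeodesicSpace X ∧
    ∀ p q r m : X, IsMidpoint m q r →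
      dist p m ^ 2 ≤ (dist p q ^ 2 + dist p r ^ 2) / 2 - dist q r ^ 2 / 4

/-- Non-positively curved = locally CAT(0): every point has a ball around it
which is CAT(0) in the induced metric. -/
def NonPositivelyCurved (X : Type*) [MetricSpace X] : Prop :=
  ∀ x : X, ∃ ε : ℝ, 0 < ε ∧ CAT0 (Metric.ball x ε)

/-! ### Cube complexes -/

/-- The unit cube in Euclidean `n`-space. -/
def unitCube (n : ℕ) : Set (EuclideanSpace ℝ (Fin n)) :=
  {x | ∀ i, x i ∈ Set.Icc (0 : ℝ) 1}

/-- The vertices (corners) of the unit cube. -/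
def cubeCorners (n : ℕ) : Set (EuclideanSpace ℝ (Fin n)) :=
  {x | ∀ i, x i = 0 ∨ x i = 1}

/-- The affine inclusion of the `i`-th face at level `ε` into the `(n+1)`-cube. -/
def faceMap {n : ℕ} (i : Fin (n + 1)) (ε : ℝ)
    (x : EuclideanSpace ℝ (Fin n)) : EuclideanSpace ℝ (Fin (n + 1)) :=
  (WithLp.equiv 2 (Fin (n + 1) → ℝ)).symm (i.insertNth ε fun j => x j)

/-- `d` is a codimension-one face of the cube chart `c`. -/
def IsImmediateFace {X : Type*}
    (d c : Σ n : ℕ, EuclideanSpace ℝ (Fin n) → X) : Prop :=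
  ∃ (n : ℕ) (f : EuclideanSpace ℝ (Fin (n + 1)) → X) (i : Fin (n + 1)) (ε : ℝ),
    (ε = 0 ∨ ε = 1) ∧ c = ⟨n + 1, f⟩ ∧ d = ⟨n, f ∘ faceMap i ε⟩

/-- `d` is an (iterated) subcube/face of `c`. -/
def IsSubcube {X : Type*} (d c : Σ n : ℕ, EuclideanSpace ℝ (Fin n) → X) : Prop :=
  Relation.ReflTransGen IsImmediateFace d c

/-- The underlying combinatorial data of a cube complex structure on a metric
space `X`: a family of cube charts, injective on the unit cube, closed under
taking faces, covering `X`, 1-Lipschitz on cubes, and such that any two cubes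
meet (if at all) in a common subcube. -/
structure PreCubeComplex (X : Type*) [MetricSpace X] where
  charts : Set (Σ n : ℕ, EuclideanSpace ℝ (Fin n) → X)
  injOn : ∀ c ∈ charts, Set.InjOn c.2 (unitCube c.1)
  closed_faces : ∀ (n : ℕ) (f : EuclideanSpace ℝ (Fin (n + 1)) → X),
    (⟨n + 1, f⟩ : Σ n : ℕ, EuclideanSpace ℝ (Fin n) → X) ∈ charts →
    ∀ (i : Fin (n + 1)) (ε : ℝ), ε = 0 ∨ ε = 1 →
    (⟨n, f ∘ faceMap i ε⟩ : Σ n : ℕ, EuclideanSpace ℝ (Fin n) → X) ∈ charts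
  cover : ∀ x : X, ∃ c ∈ charts, ∃ p ∈ unitCube c.1, c.2 p = x
  short : ∀ c ∈ charts, ∀ p ∈ unitCube c.1, ∀ q ∈ unitCube c.1,
    dist (c.2 p) (c.2 q) ≤ dist p q
  glued : ∀ c ∈ charts, ∀ d ∈ charts,
    (c.2 '' unitCube c.1 ∩ d.2 '' unitCube d.1).Nonempty →
    ∃ e ∈ charts, IsSubcube e c ∧ IsSubcube e d ∧
      e.2 '' unitCube e.1 = c.2 '' unitCube c.1 ∩ d.2 '' unitCube d.1

/-- A single step of a chain: the two points lie in a common cube, at Euclidean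
distance `r` within that cube. -/
def StepCost {X : Type*} [MetricSpace X] (C : PreCubeComplex X)
    (a b : X) (r : ℝ) : Prop :=
  ∃ c ∈ C.charts, ∃ p ∈ unitCube c.1, ∃ q ∈ unitCube c.1,
    c.2 p = a ∧ c.2 q = b ∧ r = dist p q

/-- Chains of cube-wise steps from `a` to `b` of total cost `r`. -/
inductive Chain {X : Type*} [MetricSpace X] (C : PreCubeComplex X) :
    X → X → ℝ → Prop
  | refl (a : X) : Chain C a a 0
  | step {a b c : X} {r s : ℝ} :
      StepCost C a b r → Chain C b c s → Chain C a c (r + s)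

/-- A cube complex: the metric of `X` is the intrinsic chain (length) metric
induced by the Euclidean metrics on the cubes. -/
structure CubeComplex (X : Type*) [MetricSpace X] extends PreCubeComplex X where
  dist_eq : ∀ x y : X, dist x y = sInf {r : ℝ | Chain toPreCubeComplex x y r}

/-- A vertex of the cube complex: the image of a 0-cube. -/
def CubeComplex.IsVertex {X : Type*} [MetricSpace X] (C : CubeComplex X)
    (v : X) : Prop :=
  ∃ f : EuclideanSpace ℝ (Fin 0) → X,
    (⟨0, f⟩ : Σ n : ℕ, EuclideanSpace ℝ (Fin n) → X) ∈ C.charts ∧ ∃ p, f p = v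

/-! ### Links and flagness -/

/-- The edges (1-cubes) at a vertex `v`, regarded as subsets of `X`. These are
the vertices of the link `lk(v)`. -/
def CubeComplex.EdgesAt {X : Type*} [MetricSpace X] (C : CubeComplex X)
    (v : X) : Set (Set X) :=
  {E | ∃ f : EuclideanSpace ℝ (Fin 1) → X,
    (⟨1, f⟩ : Σ n : ℕ, EuclideanSpace ℝ (Fin n) → X) ∈ C.charts ∧
    E = f '' unitCube 1 ∧ ∃ p ∈ cubeCorners 1, f p = v}

/-- For an `n`-cube chart `f` with corner `κ`, the edge of the cube at `κ` in
direction `i`, as a subset of `X`. -/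
def cornerEdge {X : Type*} {n : ℕ} (f : EuclideanSpace ℝ (Fin n) → X)
    (κ : EuclideanSpace ℝ (Fin n)) (i : Fin n) : Set X :=
  f '' {x | x ∈ unitCube n ∧ ∀ j, j ≠ i → x j = κ j}

/-- The simplices of the link of `v`: each corner of an `n`-cube at `v` (with
`n ≥ 1`) contributes the `(n-1)`-simplex spanned by its `n` incident edges. -/
def CubeComplex.LinkSimplices {X : Type*} [MetricSpace X] (C : CubeComplex X)
    (v : X) : Set (Set (Set X)) :=
  {σ | ∃ (n : ℕ) (f : EuclideanSpace ℝ (Fin n) → X)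
      (κ : EuclideanSpace ℝ (Fin n)),
    1 ≤ n ∧ (⟨n, f⟩ : Σ n : ℕ, EuclideanSpace ℝ (Fin n) → X) ∈ C.charts ∧
    κ ∈ cubeCorners n ∧ f κ = v ∧ σ = Set.range fun i : Fin n => cornerEdge f κ i}

/-- The link of `v` is a flag simplicial complex: every finite set of pairwise
adjacent vertices of `lk(v)` spans a simplex. -/
def CubeComplex.LinkFlag {X : Type*} [MetricSpace X] (C : CubeComplex X)
    (v : X) : Prop :=
  ∀ S : Set (Set X), S.Finite → S.Nonempty → S ⊆ C.EdgesAt v →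
    (∀ a ∈ S, ∀ b ∈ S, a ≠ b → ({a, b} : Set (Set X)) ∈ C.LinkSimplices v) →
    S ∈ C.LinkSimplices v


namespace GLC

section Glue
variable {Y : Type*} [MetricSpace Y]

/-- Intrinsically CAT(0) subset, in Stewart form. -/
structure IsC (U : Set Y) : Prop where
  geo : ∀ x ∈ U, ∀ y ∈ U, ∀ s, 0 ≤ s → s ≤ dist x y →
    ∃ z ∈ U, dist x z = s ∧ dist z y = dist x y - s
  st : ∀ p ∈ U, ∀ x ∈ U, ∀ y ∈ U, ∀ z ∈ U, dist x y = dist x z + dist z y →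
    dist x y * dist p z ^ 2 ≤
      dist z y * dist p x ^ 2 + dist x z * dist p y ^ 2 - dist x z * dist z y * dist x y

theorem IsC.uniq {U : Set Y} (h : IsC U) {x y z z' : Y} (hx : x ∈ U) (hy : y ∈ U) (hz : z ∈ U)
    (hz' : z' ∈ U) (hb : dist x y = dist x z + dist z y) (h1 : dist x z' = dist x z)
    (h2 : dist z' y = dist z y) : z = z' := by
  have := h.st z' hz' x hx y hy z hz hb
  rw [dist_comm z' x, h1, h2] at this
  rcases eq_or_lt_of_le (dist_nonneg (x := x) (y := y)) with h0 | h0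
  · have hxz : dist x z = 0 := by
      have := dist_nonneg (x := x) (y := z); have := dist_nonneg (x := z) (y := y); linarith
    rw [hxz] at h1
    rw [← dist_eq_zero.1 hxz, dist_eq_zero.1 h1]
  · have h3 : dist x y * dist z' z ^ 2 ≤ 0 := by
      rw [hb] at this ⊢; nlinarith
    have h4 : dist z' z ^ 2 ≤ 0 := by
      by_contra hc; push Not at hc; nlinarith [mul_pos h0 hc]
    have h5 : dist z' z = 0 := by nlinarith [dist_nonneg (x := z') (y := z)]
    exact (dist_eq_zero.1 h5).symm

/-- normalised Stewart -/
theorem st_norm {p x y z : Y} {e : ℝ} (h1 : dist x z = e * dist x y)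
    (h2 : dist z y = (1 - e) * dist x y)
    (h : dist x y * dist p z ^ 2 ≤
      dist z y * dist p x ^ 2 + dist x z * dist p y ^ 2 - dist x z * dist z y * dist x y) :
    dist p z ^ 2 ≤ (1 - e) * dist p x ^ 2 + e * dist p y ^ 2 - e * (1 - e) * dist x y ^ 2 := by
  rcases eq_or_lt_of_le (dist_nonneg (x := x) (y := y)) with h0 | h0
  · rw [← h0] at h1 h2
    simp at h1 h2
    subst h1; subst h2
    simp; linarith
  · rw [h1, h2] at h
    have : dist x y * dist p z ^ 2 ≤ dist x y *
      ((1 - e) * dist p x ^ 2 + e * dist p y ^ 2 - e * (1 - e) * dist x y ^ 2) := by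
      linarith
    exact le_of_mul_le_mul_left this h0

theorem st_unnorm {p x y z : Y} {e : ℝ} (h1 : dist x z = e * dist x y)
    (h2 : dist z y = (1 - e) * dist x y)
    (h : dist p z ^ 2 ≤ (1 - e) * dist p x ^ 2 + e * dist p y ^ 2 - e * (1 - e) * dist x y ^ 2) :
    dist x y * dist p z ^ 2 ≤
      dist z y * dist p x ^ 2 + dist x z * dist p y ^ 2 - dist x z * dist z y * dist x y := by
  rw [h1, h2]
  have := mul_le_mul_of_nonneg_left h (dist_nonneg (x := x) (y := y))
  linarith

theorem IsC.stn {U : Set Y} (h : IsC U) {p x y z : Y} {e : ℝ} (hp : p ∈ U) (hx : x ∈ U)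
    (hy : y ∈ U) (hz : z ∈ U) (h1 : dist x z = e * dist x y)
    (h2 : dist z y = (1 - e) * dist x y) :
    dist p z ^ 2 ≤ (1 - e) * dist p x ^ 2 + e * dist p y ^ 2 - e * (1 - e) * dist x y ^ 2 :=
  st_norm h1 h2 (h.st p hp x hx y hy z hz (by rw [h1, h2]; ring))

/-- The joint lemma. -/
theorem joint {x y z p : Y} (hb : dist x y = dist x z + dist z y)
    (H : ∀ e : ℝ, 0 < e → e < 1 → ∃ w,
      dist x w ^ 2 ≤ (1 - e) * dist x z ^ 2 + e * dist x p ^ 2 - e * (1 - e) * dist z p ^ 2 ∧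
      dist y w ^ 2 ≤ (1 - e) * dist y z ^ 2 + e * dist y p ^ 2 - e * (1 - e) * dist z p ^ 2) :
    dist x y * dist p z ^ 2 ≤
      dist z y * dist p x ^ 2 + dist x z * dist p y ^ 2 - dist x z * dist z y * dist x y := by
  rcases eq_or_lt_of_le (dist_nonneg (x := x) (y := z)) with ha | ha
  · have hxz := dist_eq_zero.1 ha.symm
    subst hxz; simp
  rcases eq_or_lt_of_le (dist_nonneg (x := z) (y := y)) with hb' | hb'
  · have hxz := dist_eq_zero.1 hb'.symm
    subst hxz; simp
  rw [dist_comm p x, dist_comm p y, dist_comm p z, hb]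
  rw [dist_comm z y] at *
  set a := dist x z with ha_
  set b := dist y z
  set c := dist z p
  set A := dist x p
  set B := dist y p
  -- key
  have key : ∀ e : ℝ, 0 < e → e < 1 →
      0 ≤ b * (A ^ 2 - a ^ 2 - c ^ 2) + a * (B ^ 2 - b ^ 2 - c ^ 2) + e * ((a + b) * c ^ 2) := by
    intro e he he1
    obtain ⟨w, hw1, hw2⟩ := H e he he1
    have ht : a + b ≤ dist x w + dist y w := by
      rw [← hb, dist_comm y w]; exact dist_triangle _ _ _
    have h1 : 2 * a * dist x w ≤ dist x w ^ 2 + a ^ 2 := by nlinarith [sq_nonneg (dist x w - a)]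
    have h2 : 2 * b * dist y w ≤ dist y w ^ 2 + b ^ 2 := by nlinarith [sq_nonneg (dist y w - b)]
    have h1' : 2 * a * dist x w ≤ 2 * a ^ 2 + e * (A ^ 2 - a ^ 2 - c ^ 2 + e * c ^ 2) := by
      nlinarith
    have h2' : 2 * b * dist y w ≤ 2 * b ^ 2 + e * (B ^ 2 - b ^ 2 - c ^ 2 + e * c ^ 2) := by
      nlinarith
    have h3 := mul_le_mul_of_nonneg_left h1' hb'.le
    have h4 := mul_le_mul_of_nonneg_left h2' ha.le
    have h5 := mul_le_mul_of_nonneg_left ht (mul_pos ha hb').le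
    have h6 : 0 ≤ e * (b * (A ^ 2 - a ^ 2 - c ^ 2) + a * (B ^ 2 - b ^ 2 - c ^ 2) +
      e * ((a + b) * c ^ 2)) := by nlinarith
    exact nonneg_of_mul_nonneg_right h6 he
  have key2 : 0 ≤ b * (A ^ 2 - a ^ 2 - c ^ 2) + a * (B ^ 2 - b ^ 2 - c ^ 2) := by
    by_contra hc
    push Not at hc
    set M := b * (A ^ 2 - a ^ 2 - c ^ 2) + a * (B ^ 2 - b ^ 2 - c ^ 2)
    have hN : 0 ≤ (a + b) * c ^ 2 := by positivity
    set N := (a + b) * c ^ 2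
    have hd : 0 < -M + N + 1 := by linarith
    have := key (-M / (2 * (-M + N + 1))) (by apply div_pos <;> linarith)
      (by rw [div_lt_one (by linarith)]; linarith)
    have h7 : -M / (2 * (-M + N + 1)) * N ≤ -M / 2 := by
      rw [div_mul_eq_mul_div, div_le_div_iff₀ (by linarith) (by norm_num)]
      nlinarith
    linarith
  nlinarith

/-- Alexandrov-lemma type computation. -/
theorem alex {α χ P Q ζ e pw pv vw : ℝ} (he : 0 < e) (hP : 0 < P) (hQ : 0 < Q)
    (hpw : pw ≤ pv + vw) (hpw0 : 0 ≤ pw)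
    (η : ℝ) (hη : η = e * (P + Q) / (P + e * Q))
    (h1 : pv ^ 2 ≤ (1 - η) * α ^ 2 + η * P ^ 2 - η * (1 - η) * ζ ^ 2)
    (h2 : vw ^ 2 ≤ η ^ 2 * ζ ^ 2 + e ^ 2 * χ ^ 2 - η * e * (ζ ^ 2 + χ ^ 2 - Q ^ 2)) :
    pw ^ 2 ≤ (1 - e) * α ^ 2 + e * (P + Q) ^ 2 - e * (1 - e) * χ ^ 2 := by
  have hd : 0 < P + e * Q := by positivity
  -- Cauchy with t = e Q/(P+eQ), 1-t = P/(P+eQ)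
  have hc : (pv + vw) ^ 2 * (P * (e * Q)) ≤ (pv ^ 2 * (e * Q) + vw ^ 2 * P) * (P + e * Q) := by
    nlinarith [sq_nonneg (e * Q * pv - P * vw)]
  have hs : pw ^ 2 ≤ (pv + vw) ^ 2 := by gcongr
  have hη' : η * (P + e * Q) = e * (P + Q) := by rw [hη]; field_simp
  have hpos : 0 < P * (e * Q) := by positivity
  have h3 : pw ^ 2 * (P * (e * Q)) ≤ (((1 - η) * α ^ 2 + η * P ^ 2 - η * (1 - η) * ζ ^ 2) * (e * Q)
      + (η ^ 2 * ζ ^ 2 + e ^ 2 * χ ^ 2 - η * e * (ζ ^ 2 + χ ^ 2 - Q ^ 2)) * P) * (P + e * Q) := by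
    calc _ ≤ (pv + vw) ^ 2 * (P * (e * Q)) := by gcongr
      _ ≤ _ := hc
      _ ≤ _ := by gcongr
  have h4 : (((1 - η) * α ^ 2 + η * P ^ 2 - η * (1 - η) * ζ ^ 2) * (e * Q)
      + (η ^ 2 * ζ ^ 2 + e ^ 2 * χ ^ 2 - η * e * (ζ ^ 2 + χ ^ 2 - Q ^ 2)) * P) * (P + e * Q)
      = ((1 - e) * α ^ 2 + e * (P + Q) ^ 2 - e * (1 - e) * χ ^ 2) * (P * (e * Q)) := by
    rw [hη]; field_simp; ring
  rw [h4] at h3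
  exact le_of_mul_le_mul_right h3 hpos

end Glue
end GLC


namespace GLC

section Glue
variable {Y : Type*} [MetricSpace Y]

structure GlueData (U V : Set Y) : Prop where
  hU : IsC U
  hV : IsC V
  hA : ∀ x ∈ U ∩ V, ∀ y ∈ U ∩ V, ∀ s, 0 ≤ s → s ≤ dist x y →
    ∃ z ∈ U ∩ V, dist x z = s ∧ dist z y = dist x y - s
  cross : ∀ p ∈ U, ∀ x ∈ V, ∃ z ∈ U ∩ V, dist p x = dist p z + dist z x

theorem GlueData.symm {U V : Set Y} (h : GlueData U V) : GlueData V U where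
  hU := h.hV
  hV := h.hU
  hA := by rw [Set.inter_comm]; exact h.hA
  cross := by
    intro p hp x hx
    obtain ⟨z, hz, h1⟩ := h.cross x hx p hp
    exact ⟨z, hz.symm, by rw [dist_comm p x, h1, dist_comm x z, dist_comm z p]; ring⟩

/-- points between two points of the intersection lie in the intersection -/
theorem GlueData.convA {U V : Set Y} (h : GlueData U V) {x y z : Y} (hx : x ∈ U ∩ V)
    (hy : y ∈ U ∩ V) (hz : z ∈ U) (hb : dist x y = dist x z + dist z y) : z ∈ U ∩ V := by
  obtain ⟨z', hz', h1, h2⟩ := h.hA x hx y hy (dist x z) dist_nonneg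
    (by rw [hb]; linarith [dist_nonneg (x := z) (y := y)])
  have := h.hU.uniq hx.1 hy.1 hz hz'.1 hb h1 (by rw [h2, hb]; ring)
  rw [this]; exact hz'

theorem GlueData.convV {U V : Set Y} (h : GlueData U V) {x y z : Y} (hx : x ∈ V)
    (hy : y ∈ V) (hz : z ∈ U) (hb : dist x y = dist x z + dist z y) : z ∈ V := by
  obtain ⟨a, ha, ha1⟩ := h.cross z hz x hx
  obtain ⟨b, hb', hb1⟩ := h.cross z hz y hy
  have h1 := dist_triangle4 x a b y
  have h2 := dist_triangle a z b
  rw [dist_comm a z] at h2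
  rw [dist_comm x z] at hb
  rw [dist_comm x a] at h1
  exact (h.convA ha hb' hz (by rw [dist_comm a z]; linarith)).2

theorem GlueData.sideT {U V : Set Y} (h : GlueData U V) {p c x w : Y} {e : ℝ}
    (hp : p ∈ U) (hc : c ∈ U ∩ V) (hx : x ∈ V) (hw : w ∈ V) (he0 : 0 ≤ e) (he1 : e ≤ 1)
    (h1 : dist c w = e * dist c x) (h2 : dist w x = (1 - e) * dist c x) :
    dist p w ^ 2 ≤ (1 - e) * dist p c ^ 2 + e * dist p x ^ 2 - e * (1 - e) * dist c x ^ 2 := by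
  rcases eq_or_lt_of_le he0 with he | he
  · subst he
    simp at h1; subst h1; simp
  obtain ⟨z, hz, hpz⟩ := h.cross p hp x hx
  rcases eq_or_lt_of_le (dist_nonneg (x := p) (y := z)) with hP | hP
  · have hpz' := dist_eq_zero.1 hP.symm
    subst hpz'
    exact h.hV.stn hz.2 hc.2 hx hw h1 h2
  rcases eq_or_lt_of_le (dist_nonneg (x := z) (y := x)) with hQ | hQ
  · have hpz' := dist_eq_zero.1 hQ.symm
    subst hpz'
    have hwA : w ∈ U := (h.symm.convA hc.symm hz.symm hw (by rw [h1, h2]; ring)).2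
    exact h.hU.stn hp hc.1 hz.1 hwA h1 h2
  set P := dist p z
  set Q := dist z x
  set η := e * (P + Q) / (P + e * Q) with hη
  have hd : 0 < P + e * Q := by positivity
  have hη0 : 0 ≤ η := by positivity
  have hη1 : η ≤ 1 := by rw [hη, div_le_one hd]; nlinarith
  obtain ⟨v, hv, hv1, hv2⟩ := h.hA c hc z hz (η * dist c z) (by positivity)
    (by nlinarith [dist_nonneg (x := c) (y := z)])
  have hv2' : dist v z = (1 - η) * dist c z := by rw [hv2]; ring
  have e1 := h.hU.stn hp hc.1 hz.1 hv.1 hv1 hv2'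
  have e2 := h.hV.stn hw hc.2 hz.2 hv.2 hv1 hv2'
  have e3 := h.hV.stn hz.2 hc.2 hx hw h1 h2
  have := alex (α := dist p c) (χ := dist c x) (ζ := dist c z) (pw := dist p w) (pv := dist p v)
    (vw := dist v w) he hP hQ (dist_triangle _ _ _) dist_nonneg η hη e1 (by
      rw [dist_comm v w]
      rw [dist_comm w c, dist_comm w z, h1] at e2
      rw [dist_comm z c] at e3
      have := mul_le_mul_of_nonneg_left e3 hη0
      nlinarith)
  rw [hpz]; exact this

/-- joint inequality at a crossing point -/
theorem GlueData.jointII {U V : Set Y} (h : GlueData U V) {p m w a : Y}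
    (hp : p ∈ U) (hm : m ∈ V) (hw : w ∈ V) (ha : a ∈ U ∩ V)
    (hb : dist p m = dist p a + dist a m) :
    dist p m * dist w a ^ 2 ≤
      dist a m * dist w p ^ 2 + dist p a * dist w m ^ 2 - dist p a * dist a m * dist p m := by
  apply joint hb
  intro e he he1
  obtain ⟨u, hu, hu1, hu2⟩ := h.hV.geo a ha.2 w hw (e * dist a w) (by positivity)
    (by nlinarith [dist_nonneg (x := a) (y := w)])
  have hu2' : dist u w = (1 - e) * dist a w := by rw [hu2]; ring
  exact ⟨u, h.sideT hp ha hw hu he.le he1.le hu1 hu2', h.hV.stn hm ha.2 hw hu hu1 hu2'⟩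

theorem GlueData.caseI {U V : Set Y} (h : GlueData U V) {p x y m : Y}
    (hp : p ∈ U) (hx : x ∈ V) (hy : y ∈ V) (hm : m ∈ V)
    (hb : dist x y = dist x m + dist m y) :
    dist x y * dist p m ^ 2 ≤
      dist m y * dist p x ^ 2 + dist x m * dist p y ^ 2 - dist x m * dist m y * dist x y := by
  by_cases hmU : m ∈ U
  · apply joint hb
    intro e he he1
    obtain ⟨u, hu, hu1, hu2⟩ := h.hU.geo m hmU p hp (e * dist m p) (by positivity)
      (by nlinarith [dist_nonneg (x := m) (y := p)])
    have hu2' : dist u p = (1 - e) * dist m p := by rw [hu2]; ring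
    exact ⟨u, h.symm.sideT hx ⟨hm, hmU⟩ hp hu he.le he1.le hu1 hu2',
      h.symm.sideT hy ⟨hm, hmU⟩ hp hu he.le he1.le hu1 hu2'⟩
  · obtain ⟨a, ha, hpa⟩ := h.cross p hp m hm
    have hμ : 0 < dist a m := by
      rw [dist_pos]; rintro rfl; exact hmU ha.1
    have j1 := h.jointII hp hm hx ha hpa
    have j2 := h.jointII hp hm hy ha hpa
    have j3 := h.hV.st a ha.2 x hx y hy m hm hb
    rw [dist_comm p x, dist_comm p y]
    rw [dist_comm a x, dist_comm a y] at j3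
    rw [dist_comm y m] at j2
    rw [hpa] at j1 j2 ⊢
    rw [hb] at j3 ⊢
    have hα := dist_nonneg (x := p) (y := a)
    have hs := dist_nonneg (x := x) (y := m)
    have ht := dist_nonneg (x := m) (y := y)
    set α := dist p a
    set μ := dist a m
    set s := dist x m
    set t := dist m y
    have k1 := mul_le_mul_of_nonneg_left j1 ht
    have k2 := mul_le_mul_of_nonneg_left j2 hs
    have k3 := mul_le_mul_of_nonneg_left j3 (add_nonneg hα hμ.le)
    refine le_of_mul_le_mul_left ?_ hμ
    nlinarith

/-- Stewart for a geodesic with both ends in `V`. -/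
theorem GlueData.stV {U V : Set Y} (h : GlueData U V) {p x y z : Y}
    (hp : p ∈ U ∪ V) (hx : x ∈ V) (hy : y ∈ V) (hz : z ∈ U ∪ V)
    (hb : dist x y = dist x z + dist z y) :
    dist x y * dist p z ^ 2 ≤
      dist z y * dist p x ^ 2 + dist x z * dist p y ^ 2 - dist x z * dist z y * dist x y := by
  have hzV : z ∈ V := by
    rcases hz with hz | hz
    · exact h.convV hx hy hz hb
    · exact hz
  rcases hp with hp | hp
  · exact h.caseI hp hx hy hzV hb
  · exact h.hV.st p hp x hx y hy z hzV hb

theorem GlueData.stUV {U V : Set Y} (h : GlueData U V) {p x y z : Y}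
    (hp : p ∈ U ∪ V) (hx : x ∈ U) (hy : y ∈ V) (hz : z ∈ V)
    (hb : dist x y = dist x z + dist z y) :
    dist x y * dist p z ^ 2 ≤
      dist z y * dist p x ^ 2 + dist x z * dist p y ^ 2 - dist x z * dist z y * dist x y := by
  obtain ⟨c, hc, hxc⟩ := h.cross x hx z hz
  have hcy : dist c y = dist c z + dist z y := by
    have h1 := dist_triangle x c y
    have h2 := dist_triangle c z y
    linarith
  have hxy : dist x y = dist x c + dist c y := by linarith
  have j1 : dist x y * dist p c ^ 2 ≤
      dist c y * dist p x ^ 2 + dist x c * dist p y ^ 2 - dist x c * dist c y * dist x y := by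
    rcases hp with hp | hp
    · have := h.symm.jointII hy hx hp hc.symm (by
        rw [dist_comm y x, dist_comm y c, dist_comm c x]; linarith)
      rw [dist_comm y x, dist_comm y c, dist_comm c x] at this
      linarith
    · exact h.jointII hx hy hp hc hxy
  have j2 := h.stV hp hc.2 hy (Or.inr hz) hcy
  have n1 := dist_nonneg (x := x) (y := c)
  have n2 := dist_nonneg (x := c) (y := z)
  have n3 := dist_nonneg (x := z) (y := y)
  rcases eq_or_lt_of_le (dist_nonneg (x := c) (y := y)) with h0 | h0
  · have hcz : c = z := dist_eq_zero.1 (by linarith)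
    rw [← hcz]; exact j1
  rw [hxy, hcy] at j1 ⊢
  rw [hxc]
  rw [hcy] at j2 h0
  set α := dist x c
  set β := dist c z
  set γ := dist z y
  have k1 := mul_le_mul_of_nonneg_left j1 n3
  have k2 := mul_le_mul_of_nonneg_left j2 (by positivity : 0 ≤ α + (β + γ))
  refine le_of_mul_le_mul_left ?_ h0
  nlinarith

theorem GlueData.isC {U V : Set Y} (h : GlueData U V) : IsC (U ∪ V) where
  geo := by
    have key : ∀ {U V : Set Y}, GlueData U V → ∀ x ∈ U, ∀ y ∈ V, ∀ s, 0 ≤ s → s ≤ dist x y →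
        ∃ z ∈ U ∪ V, dist x z = s ∧ dist z y = dist x y - s := by
      intro U V h x hx y hy s hs0 hs1
      obtain ⟨c, hc, hxc⟩ := h.cross x hx y hy
      rcases le_total s (dist x c) with hs | hs
      · obtain ⟨z, hz, h1, h2⟩ := h.hU.geo x hx c hc.1 s hs0 hs
        refine ⟨z, Or.inl hz, h1, le_antisymm ?_ ?_⟩
        · have := dist_triangle z c y; linarith
        · have := dist_triangle x z y; linarith
      · obtain ⟨z, hz, h1, h2⟩ := h.hV.geo c hc.2 y hy (s - dist x c) (by linarith) (by linarith)
        have t1 := dist_triangle x c z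
        have t2 := dist_triangle x z y
        exact ⟨z, Or.inr hz, by linarith, by linarith⟩
    rintro x (hx | hx) y (hy | hy) s hs0 hs1
    · obtain ⟨z, hz, h'⟩ := h.hU.geo x hx y hy s hs0 hs1
      exact ⟨z, Or.inl hz, h'⟩
    · exact key h x hx y hy s hs0 hs1
    · obtain ⟨z, hz, h'⟩ := key h.symm x hx y hy s hs0 hs1
      exact ⟨z, hz.symm, h'⟩
    · obtain ⟨z, hz, h'⟩ := h.hV.geo x hx y hy s hs0 hs1
      exact ⟨z, Or.inr hz, h'⟩
  st := by
    intro p hp x hx y hy z hz hb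
    have rev : ∀ {x y z : Y}, dist y x * dist p z ^ 2 ≤
      dist z x * dist p y ^ 2 + dist y z * dist p x ^ 2 - dist y z * dist z x * dist y x →
      dist x y * dist p z ^ 2 ≤
      dist z y * dist p x ^ 2 + dist x z * dist p y ^ 2 - dist x z * dist z y * dist x y := by
      intro x y z h
      rw [dist_comm y x, dist_comm z x, dist_comm y z] at h
      linarith
    have hb' : dist y x = dist y z + dist z x := by
      rw [dist_comm y x, dist_comm y z, dist_comm z x]; linarith
    rcases hx with hx | hx <;> rcases hy with hy | hy
    · exact h.symm.stV hp.symm hx hy hz.symm hb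
    · rcases hz with hz | hz
      · exact rev (h.symm.stUV hp.symm hy hx hz hb')
      · exact h.stUV hp hx hy hz hb
    · rcases hz with hz | hz
      · exact h.symm.stUV hp.symm hx hy hz hb
      · exact rev (h.stUV hp hy hx hz hb')
    · exact h.stV hp hx hy hz hb

end Glue
end GLC


namespace GLC

section Orth
variable {ι : Type*} [Fintype ι]

/-- support of a vector -/
def sp (x : EuclideanSpace ℝ ι) : Set ι := {i | x i ≠ 0}

/-- both points lie in a common orthant -/
def StepK (K : Set (Set ι)) (x y : EuclideanSpace ℝ ι) : Prop :=
  (∀ i, 0 ≤ x i) ∧ (∀ i, 0 ≤ y i) ∧ ∃ σ ∈ K, sp x ⊆ σ ∧ sp y ⊆ σ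

theorem StepK.symm {K : Set (Set ι)} {x y : EuclideanSpace ℝ ι} (h : StepK K x y) :
    StepK K y x := by
  obtain ⟨h1, h2, σ, h3, h4, h5⟩ := h
  exact ⟨h2, h1, σ, h3, h5, h4⟩

inductive OChain (K : Set (Set ι)) : EuclideanSpace ℝ ι → EuclideanSpace ℝ ι → ℝ → Prop
  | refl (a) : OChain K a a 0
  | step {a b c s} : StepK K a b → OChain K b c s → OChain K a c (dist a b + s)

theorem OChain.trans {K : Set (Set ι)} {a b c : EuclideanSpace ℝ ι} {r s : ℝ}
    (h : OChain K a b r) (h' : OChain K b c s) : OChain K a c (r + s) := by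
  induction h with
  | refl a => simpa using h'
  | step hs _ ih => rw [add_assoc]; exact OChain.step hs (ih h')

theorem OChain.single {K : Set (Set ι)} {a b : EuclideanSpace ℝ ι} (h : StepK K a b) :
    OChain K a b (dist a b) := by
  simpa using OChain.step h (OChain.refl b)

theorem OChain.symm {K : Set (Set ι)} {a b : EuclideanSpace ℝ ι} {r : ℝ}
    (h : OChain K a b r) : OChain K b a r := by
  induction h with
  | refl a => exact OChain.refl a
  | step hs _ ih =>
    rw [add_comm, dist_comm]; exact ih.trans (OChain.single hs.symm)

theorem OChain.le {K : Set (Set ι)} {a b : EuclideanSpace ℝ ι} {r : ℝ}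
    (h : OChain K a b r) : dist a b ≤ r := by
  induction h with
  | refl a => simp
  | step hs _ ih => exact (dist_triangle _ _ _).trans (by linarith)

/-- The orthant space of `K`. -/
structure Orth (K : Set (Set ι)) where
  val : EuclideanSpace ℝ ι
  nonneg : ∀ i, 0 ≤ val i
  mem : sp val ∈ K

variable {K : Set (Set ι)}

theorem Orth.ext' {x y : Orth K} (h : x.val = y.val) : x = y := by
  cases x; cases y; simp_all

theorem Orth.exists_chain (x y : Orth K) : ∃ r, OChain K x.val y.val r := by
  have h0 : sp (0 : EuclideanSpace ℝ ι) = ∅ := by simp [sp]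
  have h : ∀ x : Orth K, StepK K x.val 0 := fun x =>
    ⟨x.nonneg, by simp, _, x.mem, le_rfl, by rw [h0]; exact Set.empty_subset _⟩
  exact ⟨_, (OChain.single (h x)).trans (OChain.single (h y).symm)⟩

theorem Orth.bdd (x y : Orth K) : BddBelow {r | OChain K x.val y.val r} :=
  ⟨0, fun _ hr => dist_nonneg.trans hr.le⟩

noncomputable instance : MetricSpace (Orth K) where
  dist x y := sInf {r | OChain K x.val y.val r}
  dist_self x := by
    apply le_antisymm
    · exact csInf_le (Orth.bdd x x) (OChain.refl _)
    · exact le_csInf ⟨0, OChain.refl _⟩ fun r hr => dist_nonneg.trans hr.le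
  dist_comm x y := by
    congr 1; ext r; exact ⟨fun h => h.symm, fun h => h.symm⟩
  dist_triangle x y z := by
    apply le_of_forall_pos_le_add
    intro ε hε
    obtain ⟨r, hr, hr'⟩ := exists_lt_of_csInf_lt (Orth.exists_chain x y)
      (lt_add_of_pos_right (sInf {r | OChain K x.val y.val r}) (half_pos hε))
    obtain ⟨s, hs, hs'⟩ := exists_lt_of_csInf_lt (Orth.exists_chain y z)
      (lt_add_of_pos_right (sInf {r | OChain K y.val z.val r}) (half_pos hε))
    have := csInf_le (Orth.bdd x z) (hr.trans hs)
    linarith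
  eq_of_dist_eq_zero {x y} h := by
    apply Orth.ext'
    apply dist_le_zero.1
    have h : sInf {r | OChain K x.val y.val r} = 0 := h
    rw [← h]
    exact le_csInf (Orth.exists_chain x y) fun r hr => hr.le

theorem Orth.dist_def (x y : Orth K) : dist x y = sInf {r | OChain K x.val y.val r} := rfl

theorem Orth.dist_le {x y : Orth K} {r : ℝ} (h : OChain K x.val y.val r) : dist x y ≤ r :=
  csInf_le (Orth.bdd x y) h

theorem Orth.le_dist (x y : Orth K) : dist x.val y.val ≤ dist x y :=
  le_csInf (Orth.exists_chain x y) fun _ hr => hr.le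

theorem Orth.exists_chain_lt {x y : Orth K} {r : ℝ} (h : dist x y < r) :
    ∃ r' < r, OChain K x.val y.val r' := by
  obtain ⟨r', h1, h2⟩ := exists_lt_of_csInf_lt (Orth.exists_chain x y) h
  exact ⟨r', h2, h1⟩

theorem Orth.dist_eq_of_step {x y : Orth K} (h : StepK K x.val y.val) :
    dist x y = dist x.val y.val :=
  le_antisymm (Orth.dist_le (OChain.single h)) (Orth.le_dist x y)

theorem coord_le (x y : EuclideanSpace ℝ ι) (i : ι) : |x i - y i| ≤ dist x y := by
  rw [EuclideanSpace.dist_eq]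
  have h1 : dist (x i) (y i) ^ 2 ≤ ∑ i, dist (x i) (y i) ^ 2 :=
    Finset.single_le_sum (f := fun i => dist (x i) (y i) ^ 2) (fun _ _ => sq_nonneg _)
      (Finset.mem_univ i)
  rw [← Real.dist_eq]
  exact Real.le_sqrt_of_sq_le h1

theorem Orth.local_eq (x : Orth K) : ∃ δ > 0, ∀ y : Orth K, dist x.val y.val < δ →
    dist x y = dist x.val y.val := by
  classical
  have : ∃ δ > 0, ∀ i, x.val i ≠ 0 → δ ≤ x.val i := by
    have : ∀ s : Finset ι, ∃ δ > 0, ∀ i ∈ s, x.val i ≠ 0 → δ ≤ x.val i := by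
      intro s
      induction s using Finset.induction_on with
      | empty => exact ⟨1, one_pos, by simp⟩
      | insert a s _ ih =>
        obtain ⟨δ, hδ, h⟩ := ih
        by_cases ha : x.val a = 0
        · refine ⟨δ, hδ, fun i hi hi' => ?_⟩
          rcases Finset.mem_insert.1 hi with rfl | hi
          · exact absurd ha hi'
          · exact h i hi hi'
        · refine ⟨min δ (x.val a), lt_min hδ (lt_of_le_of_ne (x.nonneg a) (Ne.symm ha)), ?_⟩
          intro i hi hi'
          rcases Finset.mem_insert.1 hi with rfl | hi
          · exact min_le_right _ _
          · exact (min_le_left _ _).trans (h i hi hi')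
    obtain ⟨δ, hδ, h⟩ := this Finset.univ
    exact ⟨δ, hδ, fun i => h i (Finset.mem_univ i)⟩
  obtain ⟨δ, hδ, h⟩ := this
  refine ⟨δ, hδ, fun y hy => Orth.dist_eq_of_step ⟨x.nonneg, y.nonneg, _, y.mem, ?_, le_rfl⟩⟩
  intro i hi hyi
  have h1 := coord_le x.val y.val i
  have h2 := h i hi
  rw [hyi, sub_zero] at h1
  have := le_abs_self (x.val i)
  linarith

/-- restriction of coordinates -/
noncomputable def proj (W : Set ι) (x : EuclideanSpace ℝ ι) : EuclideanSpace ℝ ι :=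
  open Classical in WithLp.toLp 2 fun i => if i ∈ W then x i else 0

open Classical in
theorem proj_apply (W : Set ι) (x : EuclideanSpace ℝ ι) (i : ι) :
    proj W x i = if i ∈ W then x i else 0 := rfl

theorem sp_proj_subset (W : Set ι) (x : EuclideanSpace ℝ ι) : sp (proj W x) ⊆ sp x := by
  intro i hi h
  apply hi
  rw [proj_apply, h]; simp

theorem sp_proj_subset' (W : Set ι) (x : EuclideanSpace ℝ ι) : sp (proj W x) ⊆ W := by
  intro i hi
  by_contra h
  apply hi
  rw [proj_apply, if_neg h]

theorem proj_eq {W : Set ι} {x : EuclideanSpace ℝ ι} (h : sp x ⊆ W) : proj W x = x := by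
  ext i
  rw [proj_apply]
  split_ifs with hi
  · rfl
  · by_contra h'
    exact hi (h fun h'' => h' h''.symm)

theorem proj_dist (W : Set ι) (x y : EuclideanSpace ℝ ι) :
    dist (proj W x) (proj W y) ≤ dist x y := by
  rw [EuclideanSpace.dist_eq, EuclideanSpace.dist_eq]
  gcongr with i
  rw [proj_apply, proj_apply]
  split_ifs
  · exact le_rfl
  · simp

theorem proj_nonneg (W : Set ι) {x : EuclideanSpace ℝ ι} (h : ∀ i, 0 ≤ x i) (i : ι) :
    0 ≤ proj W x i := by
  rw [proj_apply]; split_ifs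
  · exact h i
  · exact le_rfl

theorem OChain.proj (W : Set ι) {a b : EuclideanSpace ℝ ι} {r : ℝ}
    (h : OChain K a b r) : ∃ r' ≤ r, OChain K (proj W a) (proj W b) r' := by
  induction h with
  | refl a => exact ⟨0, le_rfl, OChain.refl _⟩
  | @step a b c s hs _ ih =>
    obtain ⟨r', h1, h2⟩ := ih
    obtain ⟨ha, hb, σ, h3, h4, h5⟩ := hs
    exact ⟨_, add_le_add (proj_dist W a b) h1, OChain.step ⟨proj_nonneg W ha, proj_nonneg W hb, σ,
      h3, (sp_proj_subset W a).trans h4, (sp_proj_subset W b).trans h5⟩ h2⟩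

theorem OChain.cross {v w : ι} (hvw : ∀ σ ∈ K, v ∈ σ → w ∈ σ → False)
    (hd : ∀ σ ∈ K, ∀ τ ⊆ σ, τ ∈ K)
    {p x : EuclideanSpace ℝ ι} {r : ℝ} (h : OChain K p x r) (hp0 : ∀ i, 0 ≤ p i) (hpK : sp p ∈ K)
    (hp : p v = 0) (hx : x w = 0) : ∃ a : EuclideanSpace ℝ ι, ∃ r1 r2, (∀ i, 0 ≤ a i) ∧ sp a ∈ K ∧
      a v = 0 ∧ a w = 0 ∧ OChain K p a r1 ∧ OChain K a x r2 ∧ r1 + r2 ≤ r := by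
  induction h with
  | refl p => exact ⟨p, 0, 0, hp0, hpK, hp, hx, OChain.refl _, OChain.refl _, by simp⟩
  | @step p b x s hs hc ih =>
    by_cases hpw : p w = 0
    · exact ⟨p, 0, _, hp0, hpK, hp, hpw, OChain.refl _, OChain.step hs hc, by simp⟩
    · have hs' := hs
      obtain ⟨_, hb0, σ, hσ, h1, h2⟩ := hs
      have hbv : b v = 0 := by
        by_contra hbv
        exact hvw σ hσ (h2 hbv) (h1 hpw)
      obtain ⟨a, r1, r2, k1, k2, k3, k4, k5, k6, k7⟩ := ih hb0 (hd σ hσ _ h2) hbv hx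
      exact ⟨a, _, r2, k1, k2, k3, k4, OChain.step hs' k5, k6, by linarith⟩

/-- the subspace of vectors supported in `W` -/
def OW (K : Set (Set ι)) (W : Set ι) : Set (Orth K) := {x | sp x.val ⊆ W}

theorem OW_compact (hd : ∀ σ ∈ K, ∀ τ ⊆ σ, τ ∈ K) (W : Set ι) (R : ℝ) :
    IsCompact {a : Orth K | a ∈ OW K W ∧ ‖a.val‖ ≤ R} := by
  set B : Set (EuclideanSpace ℝ ι) :=
    {a | (∀ i, 0 ≤ a i) ∧ (∀ i, i ∉ W → a i = 0) ∧ sp a ∈ K} ∩ Metric.closedBall 0 R with hB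
  have hcl : IsClosed {a : EuclideanSpace ℝ ι | sp a ∈ K} := by
    have : {a : EuclideanSpace ℝ ι | sp a ∈ K} = ⋃ σ ∈ K, {a | ∀ i, i ∉ σ → a i = 0} := by
      ext a
      simp only [Set.mem_ofPred_eq, Set.mem_iUnion, exists_prop]
      constructor
      · intro h
        exact ⟨_, h, fun i hi => by simpa [sp] using hi⟩
      · rintro ⟨σ, hσ, h⟩
        refine hd σ hσ _ fun i hi => ?_
        by_contra hi'
        exact hi (h i hi')
    rw [this]
    refine Set.Finite.isClosed_biUnion (Set.toFinite K) fun σ _ => ?_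
    simp only [Set.ofPred_forall]
    refine isClosed_iInter fun i => isClosed_iInter fun _ => ?_
    exact isClosed_eq (by fun_prop) continuous_const
  have hc : IsCompact B := by
    rw [hB]
    refine (isCompact_closedBall _ _).inter_left ?_
    have : {a : EuclideanSpace ℝ ι | (∀ i, 0 ≤ a i) ∧ (∀ i, i ∉ W → a i = 0) ∧ sp a ∈ K} =
      {a | ∀ i, 0 ≤ a i} ∩ ({a | ∀ i, i ∉ W → a i = 0} ∩ {a | sp a ∈ K}) := rfl
    rw [this]
    refine IsClosed.inter ?_ (IsClosed.inter ?_ hcl)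
    · simp only [Set.ofPred_forall]
      exact isClosed_iInter fun i => isClosed_le continuous_const (by fun_prop)
    · simp only [Set.ofPred_forall]
      exact isClosed_iInter fun i => isClosed_iInter fun _ =>
        isClosed_eq (by fun_prop) continuous_const
  have : CompactSpace B := isCompact_iff_compactSpace.1 hc
  let F : B → Orth K := fun b => ⟨b.1, b.2.1.1, b.2.1.2.2⟩
  have hF : Continuous F := by
    rw [Metric.continuous_iff]
    intro b ε hε
    obtain ⟨δ, hδ, h⟩ := Orth.local_eq (F b)
    refine ⟨min δ ε, lt_min hδ hε, fun a ha => ?_⟩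
    have ha' : dist b.1 a.1 < min δ ε := by rw [dist_comm]; exact ha
    rw [dist_comm, h (F a) (lt_of_lt_of_le ha' (min_le_left _ _))]
    exact lt_of_lt_of_le ha' (min_le_right _ _)
  have him : {a : Orth K | a ∈ OW K W ∧ ‖a.val‖ ≤ R} = F '' Set.univ := by
    ext a
    simp only [Set.image_univ, Set.mem_range, Set.mem_ofPred_eq]
    constructor
    · rintro ⟨h1, h2⟩
      refine ⟨⟨a.val, ⟨a.nonneg, fun i hi => ?_, a.mem⟩, by simpa using h2⟩, rfl⟩
      by_contra h'
      exact hi (h1 h')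
    · rintro ⟨b, rfl⟩
      refine ⟨fun i hi => ?_, by simpa using b.2.2⟩
      by_contra h'
      exact hi (b.2.1.2.1 i h')
  rw [him]
  exact isCompact_univ.image hF

theorem Orth.cross {v w : ι} (hvw : ∀ σ ∈ K, v ∈ σ → w ∈ σ → False)
    (hd : ∀ σ ∈ K, ∀ τ ⊆ σ, τ ∈ K) (W : Set ι) (p x : Orth K) (hpW : p ∈ OW K W) (hxW : x ∈ OW K W)
    (hp : p.val v = 0) (hx : x.val w = 0) : ∃ a ∈ OW K W, a.val v = 0 ∧ a.val w = 0 ∧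
      dist p x = dist p a + dist a x := by
  have key : ∀ ε > 0, ∃ a ∈ OW K W, a.val v = 0 ∧ a.val w = 0 ∧
      dist p a + dist a x ≤ dist p x + ε := by
    intro ε hε
    obtain ⟨r, hr, hc⟩ := Orth.exists_chain_lt (lt_add_of_pos_right (dist p x) hε)
    obtain ⟨a, r1, r2, k1, k2, k3, k4, k5, k6, k7⟩ := hc.cross hvw hd p.nonneg p.mem hp hx
    obtain ⟨s1, l1, c1⟩ := k5.proj W
    obtain ⟨s2, l2, c2⟩ := k6.proj W
    rw [proj_eq hpW] at c1
    rw [proj_eq hxW] at c2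
    let b : Orth K := ⟨GLC.proj W a, proj_nonneg W k1, hd _ k2 _ (sp_proj_subset W a)⟩
    refine ⟨b, sp_proj_subset' W a, ?_, ?_, ?_⟩
    · change GLC.proj W a v = 0
      rw [proj_apply, k3]; simp
    · change GLC.proj W a w = 0
      rw [proj_apply, k4]; simp
    · have := Orth.dist_le (x := p) (y := b) c1
      have := Orth.dist_le (x := b) (y := x) c2
      linarith
  set W' : Set ι := W \ {v, w} with hW'
  have hW'1 : ∀ a : Orth K, a ∈ OW K W' ↔ a ∈ OW K W ∧ a.val v = 0 ∧ a.val w = 0 := by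
    intro a
    constructor
    · intro h
      refine ⟨fun i hi => (h hi).1, ?_, ?_⟩ <;>
      · by_contra h'
        exact (h h').2 (by simp)
    · rintro ⟨h1, h2, h3⟩ i hi
      refine ⟨h1 hi, ?_⟩
      rintro (rfl | rfl)
      · exact hi h2
      · exact hi h3
  have hcomp := OW_compact hd W' (‖p.val‖ + dist p x + 1)
  have hbd : ∀ a : Orth K, ∀ ε ≤ (1 : ℝ), dist p a + dist a x ≤ dist p x + ε →
      ‖a.val‖ ≤ ‖p.val‖ + dist p x + 1 := by
    intro a ε hε h
    have h1 := Orth.le_dist p a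
    have h2 : ‖a.val‖ ≤ ‖p.val‖ + dist p.val a.val := by
      rw [dist_eq_norm, norm_sub_rev]
      have := norm_add_le p.val (a.val - p.val)
      simpa using this
    have := dist_nonneg (x := a) (y := x)
    linarith
  obtain ⟨a1, ha1, ha2, ha3, ha4⟩ := key 1 one_pos
  obtain ⟨a, ⟨haW, haR⟩, hmin⟩ := hcomp.exists_isMinOn (f := fun a => dist p a + dist a x)
    ⟨a1, (hW'1 a1).2 ⟨ha1, ha2, ha3⟩, hbd a1 1 le_rfl ha4⟩ (by fun_prop)
  obtain ⟨h1, h2, h3⟩ := (hW'1 a).1 haW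
  refine ⟨a, h1, h2, h3, le_antisymm (dist_triangle _ _ _) ?_⟩
  apply le_of_forall_pos_le_add
  intro ε hε
  obtain ⟨b, hb1, hb2, hb3, hb4⟩ := key (min ε 1) (lt_min hε one_pos)
  have := hmin (a := b) ⟨(hW'1 b).2 ⟨hb1, hb2, hb3⟩, hbd b _ (min_le_right _ _) hb4⟩
  have h' : dist p a + dist a x ≤ dist p b + dist b x := this
  have := min_le_left ε 1
  linarith

end Orth
end GLC


namespace GLC

theorem stewart_eucl {E : Type*} [NormedAddCommGroup E] [InnerProductSpace ℝ E] (p x y z : E)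
    (hb : dist x y = dist x z + dist z y) : dist x y * dist p z ^ 2 ≤
      dist z y * dist p x ^ 2 + dist x z * dist p y ^ 2 - dist x z * dist z y * dist x y := by
  obtain ⟨t, ⟨ht0, ht1⟩, rfl⟩ := dist_add_dist_eq_iff.1 hb.symm
  have h1 : dist x (AffineMap.lineMap x y t) = t * dist x y := by
    rw [dist_left_lineMap, Real.norm_of_nonneg ht0]
  have h2 : dist (AffineMap.lineMap x y t) y = (1 - t) * dist x y := by
    rw [dist_lineMap_right, Real.norm_of_nonneg (by linarith)]
  apply st_unnorm h1 h2
  rw [dist_eq_norm, dist_eq_norm, dist_eq_norm, dist_eq_norm]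
  have e1 : p - (AffineMap.lineMap x y t) = (1 - t) • (p - x) + t • (p - y) := by
    rw [AffineMap.lineMap_apply_module]; module
  have e2 : x - y = (p - y) - (p - x) := by abel
  rw [e1, e2, norm_add_sq_real, norm_sub_sq_real (p - y) (p - x), norm_smul, norm_smul, inner_smul_left,
    inner_smul_right, Real.norm_of_nonneg ht0, Real.norm_of_nonneg (by linarith : 0 ≤ 1 - t),
    real_inner_comm (p - x) (p - y)]
  simp
  apply le_of_eq; ring

section
variable {ι : Type*} [Fintype ι] {K : Set (Set ι)}

theorem isC_OW_of_mem (W : Set ι) (hd : ∀ σ ∈ K, ∀ τ ⊆ σ, τ ∈ K) (hW : W ∈ K) :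
    IsC (OW K W) := by
  have hdist : ∀ x ∈ OW K W, ∀ y ∈ OW K W, dist x y = dist x.val y.val := fun x hx y hy =>
    Orth.dist_eq_of_step ⟨x.nonneg, y.nonneg, W, hW, hx, hy⟩
  refine ⟨?_, ?_⟩
  · intro x hx y hy s hs0 hs1
    rcases eq_or_lt_of_le (dist_nonneg (x := x) (y := y)) with h0 | h0
    · exact ⟨x, hx, by rw [dist_self]; linarith, by linarith⟩
    set t := s / dist x y with ht
    have ht0 : 0 ≤ t := by positivity
    have ht1 : t ≤ 1 := by rw [ht, div_le_one h0]; exact hs1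
    have hts : t * dist x y = s := by rw [ht]; field_simp
    have hv : ∀ i, (AffineMap.lineMap x.val y.val t : EuclideanSpace ℝ ι) i =
        (1 - t) * x.val i + t * y.val i := by
      intro i; rw [AffineMap.lineMap_apply_module]; simp
    have hsub : sp (AffineMap.lineMap x.val y.val t : EuclideanSpace ℝ ι) ⊆ W := by
      intro i hi
      by_contra hiW
      apply hi
      have h1 : x.val i = 0 := by by_contra h; exact hiW (hx h)
      have h2 : y.val i = 0 := by by_contra h; exact hiW (hy h)
      rw [hv, h1, h2]; simp
    let z : Orth K := ⟨AffineMap.lineMap x.val y.val t, fun i => by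
      rw [hv]
      have := x.nonneg i; have := y.nonneg i
      have : 0 ≤ 1 - t := by linarith
      positivity, hd _ hW _ hsub⟩
    have hz : z ∈ OW K W := hsub
    refine ⟨z, hz, ?_, ?_⟩
    · rw [hdist x hx z hz]
      change dist x.val (AffineMap.lineMap x.val y.val t) = s
      rw [dist_left_lineMap, Real.norm_of_nonneg ht0, ← hdist x hx y hy, hts]
    · rw [hdist z hz y hy]
      change dist (AffineMap.lineMap x.val y.val t) y.val = _
      rw [dist_lineMap_right, Real.norm_of_nonneg (by linarith), ← hdist x hx y hy]
      linarith
  · intro p hp x hx y hy z hz hb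
    rw [hdist x hx y hy, hdist x hx z hz, hdist z hz y hy] at hb ⊢
    rw [hdist p hp x hx, hdist p hp z hz, hdist p hp y hy]
    exact stewart_eucl _ _ _ _ hb

theorem isC_OW (hd : ∀ σ ∈ K, ∀ τ ⊆ σ, τ ∈ K) (h1 : ∀ i, {i} ∈ K)
    (hf : ∀ σ : Set ι, (∀ a ∈ σ, ∀ b ∈ σ, {a, b} ∈ K) → σ ∈ K) (W : Set ι) :
    IsC (OW K W) := by
  classical
  induction hn : W.ncard using Nat.strong_induction_on generalizing W with
  | _ n ih =>
  by_cases hc : ∀ a ∈ W, ∀ b ∈ W, {a, b} ∈ K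
  · exact isC_OW_of_mem W hd (hf W hc)
  push Not at hc
  obtain ⟨v, hv, w, hw, hvw⟩ := hc
  have hne : v ≠ w := by
    rintro rfl
    apply hvw; simpa using h1 v
  have hvw' : ∀ σ ∈ K, v ∈ σ → w ∈ σ → False := by
    intro σ hσ h2 h3
    apply hvw
    apply hd σ hσ
    rintro i (rfl | rfl) <;> assumption
  have hlt : ∀ W' : Set ι, W' ⊂ W → W'.ncard < n := by
    intro W' h; rw [← hn]; exact Set.ncard_lt_ncard h (Set.toFinite _)
  have mem : ∀ (u : ι) (W : Set ι) (x : Orth K), x ∈ OW K (W \ {u}) ↔ x ∈ OW K W ∧ x.val u = 0 := by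
    intro u W x
    constructor
    · intro h
      refine ⟨fun i hi => (h hi).1, ?_⟩
      by_contra h'
      exact (h h').2 rfl
    · rintro ⟨h1, h2⟩ i hi
      refine ⟨h1 hi, ?_⟩
      rintro rfl
      exact hi h2
  have sub : ∀ (u : ι) (W : Set ι), u ∈ W → W \ {u} ⊂ W := by
    intro u W hu
    refine ⟨Set.sdiff_subset, fun h => ?_⟩
    exact (h hu).2 rfl
  have hA : OW K (W \ {v}) ∩ OW K (W \ {w}) = OW K ((W \ {v}) \ {w}) := by
    ext x
    rw [mem w (W \ {v}) x, Set.mem_inter_iff, mem w W x, mem v W x]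
    tauto
  have hG : GlueData (OW K (W \ {v})) (OW K (W \ {w})) := by
    refine ⟨ih _ (hlt _ (sub v W hv)) _ rfl, ih _ (hlt _ (sub w W hw)) _ rfl, ?_, ?_⟩
    · rw [hA]
      refine (ih _ (hlt _ ?_) _ rfl).geo
      exact (sub w (W \ {v}) ⟨hw, hne.symm⟩).trans (sub v W hv)
    · intro p hp x hx
      rw [mem] at hp hx
      obtain ⟨a, k1, k2, k3, k4⟩ := Orth.cross hvw' hd W p x hp.1 hx.1 hp.2 hx.2
      exact ⟨a, ⟨(mem _ _ _).2 ⟨k1, k2⟩, (mem _ _ _).2 ⟨k1, k3⟩⟩, k4⟩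
  have hU : OW K W = OW K (W \ {v}) ∪ OW K (W \ {w}) := by
    ext x
    rw [Set.mem_union, mem, mem]
    have : x.val v = 0 ∨ x.val w = 0 := by
      by_contra h
      push Not at h
      exact hvw' _ x.mem h.1 h.2
    tauto
  rw [hU]
  exact hG.isC

theorem isC_univ (hd : ∀ σ ∈ K, ∀ τ ⊆ σ, τ ∈ K) (h1 : ∀ i, {i} ∈ K)
    (hf : ∀ σ : Set ι, (∀ a ∈ σ, ∀ b ∈ σ, {a, b} ∈ K) → σ ∈ K) :
    IsC (Set.univ : Set (Orth K)) := by
  have := isC_OW hd h1 hf Set.univ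
  have h : OW K Set.univ = Set.univ := by ext x; simp [OW]
  rwa [h] at this

end

theorem IsC.geodesic {Y : Type*} [MetricSpace Y] (h : IsC (Set.univ : Set Y)) (x y : Y) :
    ∃ γ : ℝ → Y, γ 0 = x ∧ γ (dist x y) = y ∧
      (∀ s ∈ Set.Icc (0 : ℝ) (dist x y), dist x (γ s) = s ∧ dist (γ s) y = dist x y - s) ∧
      ∀ s ∈ Set.Icc (0 : ℝ) (dist x y), ∀ t ∈ Set.Icc (0 : ℝ) (dist x y),
      dist (γ s) (γ t) = |s - t| := by
  have hex : ∀ s : ℝ, ∃ z : Y, s ∈ Set.Icc (0 : ℝ) (dist x y) →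
      dist x z = s ∧ dist z y = dist x y - s := by
    intro s
    by_cases hs : s ∈ Set.Icc (0 : ℝ) (dist x y)
    · obtain ⟨z, _, hz⟩ := h.geo x trivial y trivial s hs.1 hs.2
      exact ⟨z, fun _ => hz⟩
    · exact ⟨x, fun h => absurd h hs⟩
  choose γ hγ using hex
  have key : ∀ s t : ℝ, 0 ≤ s → s ≤ t → t ≤ dist x y → dist (γ s) (γ t) = t - s := by
    intro s t h0 hst h1
    obtain ⟨a1, a2⟩ := hγ s ⟨h0, hst.trans h1⟩
    obtain ⟨b1, b2⟩ := hγ t ⟨h0.trans hst, h1⟩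
    obtain ⟨z, _, c1, c2⟩ := h.geo x trivial (γ t) trivial s h0 (by rw [b1]; exact hst)
    have t1 := dist_triangle z (γ t) y
    have t2 := dist_triangle x z y
    have := h.uniq (x := x) (y := y) (z := γ s) (z' := z) trivial trivial trivial trivial
      (by rw [a1, a2]; ring) (by rw [a1, c1]) (by rw [a2]; linarith)
    rw [this, c2, b1]
  refine ⟨γ, ?_, ?_, fun s => hγ s, ?_⟩
  · have := (hγ 0 ⟨le_rfl, dist_nonneg⟩).1
    exact (dist_eq_zero.1 this).symm
  · have := (hγ (dist x y) ⟨dist_nonneg, le_rfl⟩).2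
    rw [sub_self] at this
    exact dist_eq_zero.1 this
  · intro s hs t ht
    rcases le_total s t with hst | hst
    · rw [key s t hs.1 hst ht.2, abs_sub_comm, abs_of_nonneg (by linarith)]
    · rw [dist_comm, key t s ht.1 hst hs.2, abs_of_nonneg (by linarith)]

end GLC


namespace GLC

section Cubes
variable {X : Type*}

abbrev Eu (n : ℕ) := EuclideanSpace ℝ (Fin n)

/-- explicit description of a face inclusion of charts -/
structure Fc {k n : ℕ} (g : Eu k → X) (f : Eu n → X) where
  φ : Fin k → Fin n
  inj : Function.Injective φ
  b : Fin n → ℝ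
  hb : ∀ i, b i = 0 ∨ b i = 1
  i : Eu k → Eu n
  hi : ∀ x j, i x (φ j) = x j
  hi' : ∀ x l, l ∉ Set.range φ → i x l = b l
  eq : g = f ∘ i

theorem Fc.ap {k n : ℕ} {g : Eu k → X} {f : Eu n → X} (F : Fc g f) (x : Eu k) : g x = f (F.i x) :=
  congrFun F.eq x

theorem faceMap_same {n : ℕ} (i : Fin (n + 1)) (ε : ℝ) (x : Eu n) : faceMap i ε x i = ε := by
  simp [faceMap]

theorem faceMap_succAbove {n : ℕ} (i : Fin (n + 1)) (ε : ℝ) (x : Eu n) (j : Fin n) :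
    faceMap i ε x (i.succAbove j) = x j := by
  simp [faceMap]

theorem Fc.of_subcube {d c : Σ n : ℕ, EuclideanSpace ℝ (Fin n) → X} (h : IsSubcube d c) :
    Nonempty (Fc d.2 c.2) := by
  induction h with
  | refl =>
    exact ⟨⟨id, Function.injective_id, fun _ => 0, fun _ => Or.inl rfl, id, fun _ _ => rfl,
      fun x l hl => absurd ⟨l, rfl⟩ hl, rfl⟩⟩
  | tail _ hs ih =>
    obtain ⟨n, f, i, ε, hε, rfl, rfl⟩ := hs
    obtain ⟨F⟩ := ih
    refine ⟨⟨fun j => i.succAbove (F.φ j), fun a b hab => F.inj (Fin.succAbove_right_injective hab),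
      i.insertNth ε F.b, ?_, fun x => faceMap i ε (F.i x), ?_, ?_, ?_⟩⟩
    · intro l
      refine Fin.succAboveCases i ?_ (fun j => ?_) l
      · simpa using hε
      · simpa using F.hb j
    · intro x j
      dsimp only
      rw [faceMap_succAbove, F.hi]
    · intro x l
      dsimp only
      refine Fin.succAboveCases i ?_ (fun j => ?_) l
      · intro _; rw [faceMap_same]; simp
      · intro hj
        rw [faceMap_succAbove, F.hi']
        · simp
        · rintro ⟨m, rfl⟩
          exact hj ⟨m, rfl⟩
    · exact funext fun x => F.ap x

theorem Fc.mem_cube {k n : ℕ} {g : Eu k → X} {f : Eu n → X} (F : Fc g f) {x : Eu k}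
    (hx : x ∈ unitCube k) : F.i x ∈ unitCube n := by
  intro l
  by_cases hl : l ∈ Set.range F.φ
  · obtain ⟨j, rfl⟩ := hl
    rw [F.hi]; exact hx j
  · rw [F.hi' x l hl]
    rcases F.hb l with h | h <;> rw [h] <;> simp

/-- pull back of a vector -/
noncomputable def Fc.pb {k n : ℕ} {g : Eu k → X} {f : Eu n → X} (F : Fc g f) (y : Eu n) : Eu k :=
  WithLp.toLp 2 fun j => y (F.φ j)

theorem Fc.pb_apply {k n : ℕ} {g : Eu k → X} {f : Eu n → X} (F : Fc g f) (y : Eu n) (j : Fin k) :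
    F.pb y j = y (F.φ j) := rfl

theorem Fc.i_pb {k n : ℕ} {g : Eu k → X} {f : Eu n → X} (F : Fc g f) {y : Eu n}
    (h : ∀ l, l ∉ Set.range F.φ → y l = F.b l) : F.i (F.pb y) = y := by
  ext l
  by_cases hl : l ∈ Set.range F.φ
  · obtain ⟨j, rfl⟩ := hl
    rw [F.hi, F.pb_apply]
  · rw [F.hi' _ l hl, h l hl]

theorem Fc.pb_cube {k n : ℕ} {g : Eu k → X} {f : Eu n → X} (F : Fc g f) {y : Eu n}
    (h : y ∈ unitCube n) : F.pb y ∈ unitCube k := fun j => h (F.φ j)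

theorem Fc.pb_corner {k n : ℕ} {g : Eu k → X} {f : Eu n → X} (F : Fc g f) {y : Eu n}
    (h : y ∈ cubeCorners n) : F.pb y ∈ cubeCorners k := fun j => h (F.φ j)

theorem corner_cube {n : ℕ} {y : Eu n} (h : y ∈ cubeCorners n) : y ∈ unitCube n := by
  intro i
  rcases h i with h | h <;> rw [h] <;> simp

theorem Fc.i_corner {k n : ℕ} {g : Eu k → X} {f : Eu n → X} (F : Fc g f) {x : Eu k}
    (hx : x ∈ cubeCorners k) : F.i x ∈ cubeCorners n := by
  intro l
  by_cases hl : l ∈ Set.range F.φ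
  · obtain ⟨j, rfl⟩ := hl
    rw [F.hi]; exact hx j
  · rw [F.hi' x l hl]; exact F.hb l

variable [MetricSpace X]

theorem inter {C : CubeComplex X} {m n : ℕ} {f : Eu m → X} {f' : Eu n → X}
    (hf : ⟨m, f⟩ ∈ C.charts) (hf' : ⟨n, f'⟩ ∈ C.charts) {x : X} (hx : x ∈ f '' unitCube m)
    (hx' : x ∈ f' '' unitCube n) : ∃ (k : ℕ) (g : Eu k → X), ⟨k, g⟩ ∈ C.charts ∧
      Nonempty (Fc g f) ∧ Nonempty (Fc g f') ∧
      g '' unitCube k = f '' unitCube m ∩ f' '' unitCube n := by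
  obtain ⟨⟨k, g⟩, he, h1, h2, h3⟩ := C.glued _ hf _ hf' ⟨x, hx, hx'⟩
  exact ⟨k, g, he, Fc.of_subcube h1, Fc.of_subcube h2, h3⟩

/-- a cube with a corner at `v` -/
structure CC (C : CubeComplex X) (v : X) {n : ℕ} (f : Eu n → X) (κ : Eu n) : Prop where
  mem : ⟨n, f⟩ ∈ C.charts
  cor : κ ∈ cubeCorners n
  eq : f κ = v

variable {C : CubeComplex X} {v : X}

theorem CC.inj {n : ℕ} {f : Eu n → X} {κ : Eu n} (h : CC C v f κ) {p q : Eu n}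
    (hp : p ∈ unitCube n) (hq : q ∈ unitCube n) (he : f p = f q) : p = q :=
  C.injOn _ h.mem hp hq he

theorem CC.mem_image {n : ℕ} {f : Eu n → X} {κ : Eu n} (h : CC C v f κ) :
    v ∈ f '' unitCube n := ⟨κ, corner_cube h.cor, h.eq⟩

/-- the opposite vertex along the edge -/
noncomputable def flip {n : ℕ} (κ : Eu n) (i : Fin n) : Eu n :=
  WithLp.toLp 2 (Function.update (fun j => κ j) i (1 - κ i))

theorem flip_same {n : ℕ} (κ : Eu n) (i : Fin n) : flip κ i i = 1 - κ i := by
  simp [flip]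

theorem flip_ne {n : ℕ} (κ : Eu n) {i j : Fin n} (h : j ≠ i) : flip κ i j = κ j := by
  simp [flip, h]

theorem flip_corner {n : ℕ} {κ : Eu n} (h : κ ∈ cubeCorners n) (i : Fin n) :
    flip κ i ∈ cubeCorners n := by
  intro j
  by_cases hj : j = i
  · subst hj; rw [flip_same]
    rcases h j with h | h <;> rw [h] <;> simp
  · rw [flip_ne κ hj]; exact h j

theorem flip_mem_edge {n : ℕ} (f : Eu n → X) {κ : Eu n} (h : κ ∈ cubeCorners n) (i : Fin n) :
    f (flip κ i) ∈ cornerEdge f κ i :=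
  ⟨_, ⟨corner_cube (flip_corner h i), fun _ hj => flip_ne κ hj⟩, rfl⟩

theorem flip_same_ne {n : ℕ} {κ : Eu n} (h : κ ∈ cubeCorners n) (i : Fin n) :
    flip κ i i ≠ κ i := by
  rw [flip_same]
  rcases h i with h | h <;> rw [h] <;> simp

theorem CC.edge_inj {n : ℕ} {f : Eu n → X} {κ : Eu n} (h : CC C v f κ) :
    Function.Injective (cornerEdge f κ) := by
  intro i j hij
  by_contra hne
  have h1 := flip_mem_edge f h.cor i
  rw [hij] at h1
  obtain ⟨y, ⟨hy1, hy2⟩, hy3⟩ := h1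
  have := h.inj hy1 (corner_cube (flip_corner h.cor i)) hy3
  have h2 := hy2 i hne
  rw [this] at h2
  exact flip_same_ne h.cor i h2

open Classical in
/-- coordinates of a point of a cube with respect to the edges at a corner -/
noncomputable def crd {n : ℕ} (f : Eu n → X) (κ p : Eu n) : Set X → ℝ :=
  fun E => ∑ i, if cornerEdge f κ i = E then |p i - κ i| else 0

theorem CC.crd_edge {n : ℕ} {f : Eu n → X} {κ : Eu n} (h : CC C v f κ) (p : Eu n) (i : Fin n) :
    crd f κ p (cornerEdge f κ i) = |p i - κ i| := by
  classical
  rw [crd, Finset.sum_eq_single i]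
  · simp
  · intro j _ hj
    rw [if_neg fun h' => hj (h.edge_inj h')]
  · simp

theorem crd_ne {n : ℕ} (f : Eu n → X) (κ p : Eu n) {E : Set X}
    (hE : E ∉ Set.range (cornerEdge f κ)) : crd f κ p E = 0 := by
  classical
  rw [crd]
  apply Finset.sum_eq_zero
  intro i _
  rw [if_neg fun h => hE ⟨i, h⟩]

theorem crd_nonneg {n : ℕ} (f : Eu n → X) (κ p : Eu n) (E : Set X) : 0 ≤ crd f κ p E := by
  classical
  rw [crd]
  apply Finset.sum_nonneg
  intro i _
  split_ifs <;> simp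

theorem abs_sub_corner_le {n : ℕ} {κ p : Eu n} (hκ : κ ∈ cubeCorners n) (hp : p ∈ unitCube n)
    (i : Fin n) : |p i - κ i| ≤ 1 := by
  have := hp i
  rw [abs_le]
  rcases hκ i with h | h <;> rw [h] <;> constructor <;> linarith [this.1, this.2]

theorem abs_sub_abs_corner {n : ℕ} {κ p q : Eu n} (hκ : κ ∈ cubeCorners n) (hp : p ∈ unitCube n)
    (hq : q ∈ unitCube n) (i : Fin n) :
    |(|p i - κ i|) - (|q i - κ i|)| = |p i - q i| := by
  have h1 := hp i
  have h2 := hq i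
  rcases hκ i with h | h <;> rw [h]
  · rw [sub_zero, sub_zero, abs_of_nonneg h1.1, abs_of_nonneg h2.1]
  · rw [abs_of_nonpos (by linarith [h1.2] : p i - 1 ≤ 0),
      abs_of_nonpos (by linarith [h2.2] : q i - 1 ≤ 0), abs_sub_comm (p i)]
    congr 1; ring

theorem CC.crd_inj {n : ℕ} {f : Eu n → X} {κ : Eu n} (h : CC C v f κ) {p q : Eu n}
    (hp : p ∈ unitCube n) (hq : q ∈ unitCube n) (he : crd f κ p = crd f κ q) : p = q := by
  ext i
  have h1 := abs_sub_abs_corner h.cor hp hq i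
  rw [← h.crd_edge, ← h.crd_edge, he, sub_self, abs_zero] at h1
  exact sub_eq_zero.1 (abs_eq_zero.1 h1.symm)

theorem Fc.corner {k n : ℕ} {g : Eu k → X} {f : Eu n → X} (F : Fc g f) {κ : Eu n}
    (h : CC C v f κ) (hg : ⟨k, g⟩ ∈ C.charts) (hv : v ∈ g '' unitCube k) :
    CC C v g (F.pb κ) ∧ F.i (F.pb κ) = κ := by
  obtain ⟨q, hq, hqv⟩ := hv
  have h1 : F.i q = κ := by
    apply h.inj (F.mem_cube hq) (corner_cube h.cor)
    rw [h.eq, ← hqv, F.ap]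
  have h2 : F.pb κ = q := by
    ext j; rw [F.pb_apply, ← h1, F.hi]
  exact ⟨⟨hg, F.pb_corner h.cor, by rw [h2, hqv]⟩, by rw [h2, h1]⟩

theorem Fc.edge {k n : ℕ} {g : Eu k → X} {f : Eu n → X} (F : Fc g f) {κ : Eu k} (j : Fin k) :
    cornerEdge g κ j = cornerEdge f (F.i κ) (F.φ j) := by
  ext x
  constructor
  · rintro ⟨y, ⟨hy1, hy2⟩, rfl⟩
    refine ⟨F.i y, ⟨F.mem_cube hy1, ?_⟩, (F.ap y).symm⟩
    intro l hl
    by_cases hl' : l ∈ Set.range F.φ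
    · obtain ⟨m, rfl⟩ := hl'
      rw [F.hi, F.hi]
      exact hy2 m fun h => hl (by rw [h])
    · rw [F.hi' _ l hl', F.hi' _ l hl']
  · rintro ⟨y, ⟨hy1, hy2⟩, rfl⟩
    have h1 : F.i (F.pb y) = y := by
      apply F.i_pb
      intro l hl
      rw [hy2 l (fun h => hl ⟨j, h.symm⟩), F.hi' _ l hl]
    refine ⟨F.pb y, ⟨F.pb_cube hy1, ?_⟩, by rw [F.ap, h1]⟩
    intro m hm
    rw [F.pb_apply, hy2 _ (fun h => hm (F.inj h)), F.hi]

theorem Fc.crd_eq {k n : ℕ} {g : Eu k → X} {f : Eu n → X} (F : Fc g f) {κ : Eu k}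
    (hg : CC C v g κ) (hf : CC C v f (F.i κ)) (p : Eu k) :
    crd g κ p = crd f (F.i κ) (F.i p) := by
  ext E
  by_cases hE : E ∈ Set.range (cornerEdge f (F.i κ))
  · obtain ⟨l, rfl⟩ := hE
    rw [hf.crd_edge]
    by_cases hl : l ∈ Set.range F.φ
    · obtain ⟨j, rfl⟩ := hl
      rw [← F.edge, hg.crd_edge, F.hi, F.hi]
    · rw [F.hi' _ l hl, F.hi' _ l hl, sub_self, abs_zero, crd_ne]
      rintro ⟨j, hj⟩
      rw [F.edge] at hj
      exact hl ⟨j, hf.edge_inj hj⟩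
  · rw [crd_ne f _ _ hE, crd_ne]
    rintro ⟨j, rfl⟩
    exact hE ⟨F.φ j, (F.edge j).symm⟩

/-- coordinates do not depend on the cube -/
theorem crd_unique {m n : ℕ} {f : Eu m → X} {f' : Eu n → X} {κ : Eu m} {κ' : Eu n}
    (h : CC C v f κ) (h' : CC C v f' κ') {p : Eu m} {p' : Eu n} (hp : p ∈ unitCube m)
    (hp' : p' ∈ unitCube n) (he : f p = f' p') : crd f κ p = crd f' κ' p' := by
  obtain ⟨k, g, hg, ⟨F⟩, ⟨F'⟩, him⟩ := inter h.mem h'.mem h.mem_image h'.mem_image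
  have hv : v ∈ g '' unitCube k := by rw [him]; exact ⟨h.mem_image, h'.mem_image⟩
  have hx : f p ∈ g '' unitCube k := by rw [him]; exact ⟨⟨p, hp, rfl⟩, ⟨p', hp', he.symm⟩⟩
  obtain ⟨q, hq, hqx⟩ := hx
  have hqp : F.i q = p := h.inj (F.mem_cube hq) hp (by rw [← hqx, F.ap])
  have hqp' : F'.i q = p' := h'.inj (F'.mem_cube hq) hp' (by rw [← he, ← hqx, F'.ap])
  obtain ⟨a1, a2⟩ := F.corner h hg hv
  obtain ⟨b1, b2⟩ := F'.corner h' hg hv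
  have hk : F.pb κ = F'.pb κ' := C.injOn _ hg (corner_cube a1.cor) (corner_cube b1.cor)
    (by change g _ = g _; rw [a1.eq, b1.eq])
  rw [← hqp, ← hqp', ← a2, ← b2, ← F.crd_eq a1 (by rw [a2]; exact h),
    ← F'.crd_eq b1 (by rw [b2]; exact h'), hk]

theorem mem_of_supp {m n : ℕ} {f : Eu m → X} {f' : Eu n → X} {κ : Eu m} {κ' : Eu n}
    (h : CC C v f κ) (h' : CC C v f' κ') {p : Eu m} (hp : p ∈ unitCube m)
    (hs : ∀ E, crd f κ p E ≠ 0 → E ∈ Set.range (cornerEdge f' κ')) :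
    ∃ q ∈ unitCube n, f' q = f p := by
  obtain ⟨k, g, hg, ⟨F⟩, ⟨F'⟩, him⟩ := inter h.mem h'.mem h.mem_image h'.mem_image
  have hv : v ∈ g '' unitCube k := by rw [him]; exact ⟨h.mem_image, h'.mem_image⟩
  obtain ⟨a1, a2⟩ := F.corner h hg hv
  have hpp : F.i (F.pb p) = p := by
    apply F.i_pb
    intro l hl
    have hkl : κ l = F.b l := by rw [← a2, F.hi' _ l hl]
    by_contra hne
    rw [← hkl] at hne
    have h1 := hs (cornerEdge f κ l) (by
      rw [h.crd_edge]; exact abs_ne_zero.2 (sub_ne_zero.2 hne))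
    obtain ⟨j, hj⟩ := h1
    have h2 := flip_mem_edge f h.cor l
    have h3 : f (flip κ l) ∈ f' '' unitCube n := by
      rw [← hj] at h2
      obtain ⟨y, hy, hy'⟩ := h2
      exact ⟨y, hy.1, hy'⟩
    have h4 : f (flip κ l) ∈ g '' unitCube k := by
      rw [him]; exact ⟨⟨_, corner_cube (flip_corner h.cor l), rfl⟩, h3⟩
    obtain ⟨q, hq, hq'⟩ := h4
    have h5 : F.i q = flip κ l := h.inj (F.mem_cube hq) (corner_cube (flip_corner h.cor l))
      (by rw [← hq', F.ap])
    have h6 := F.hi' q l hl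
    rw [h5, ← hkl] at h6
    exact flip_same_ne h.cor l h6
  refine ⟨F'.i (F.pb p), F'.mem_cube (F.pb_cube hp), ?_⟩
  have e1 : g (F.pb p) = f (F.i (F.pb p)) := F.ap _
  have e2 : g (F.pb p) = f' (F'.i (F.pb p)) := F'.ap _
  rw [← e2, e1, hpp]

/-- realisation of prescribed coordinates -/
theorem CC.exists_crd {n : ℕ} {f : Eu n → X} {κ : Eu n} (h : CC C v f κ) (u : Set X → ℝ)
    (h0 : ∀ E, 0 ≤ u E) (h1 : ∀ E, u E ≤ 1)
    (hs : ∀ E, u E ≠ 0 → E ∈ Set.range (cornerEdge f κ)) :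
    ∃ p ∈ unitCube n, crd f κ p = u := by
  refine ⟨WithLp.toLp 2 fun i => κ i + (1 - 2 * κ i) * u (cornerEdge f κ i), ?_, ?_⟩
  · intro i
    have a := h0 (cornerEdge f κ i)
    have b := h1 (cornerEdge f κ i)
    rcases h.cor i with hk | hk <;> simp [hk] <;> constructor <;> linarith
  · ext E
    by_cases hE : E ∈ Set.range (cornerEdge f κ)
    · obtain ⟨i, rfl⟩ := hE
      rw [h.crd_edge]
      have a := h0 (cornerEdge f κ i)
      rcases h.cor i with hk | hk
      · simp [hk, abs_of_nonneg a]
      · simp [hk, abs_of_nonneg a]; norm_num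
    · rw [crd_ne _ _ _ hE]
      by_contra hne
      exact hE (hs E (Ne.symm hne))

/-- cubes meeting the open star of `v` contain `v` -/
theorem CC.of_lt_one {m n : ℕ} {f : Eu m → X} {c : Eu n → X} {κ : Eu m}
    (h : CC C v f κ) (hc : ⟨n, c⟩ ∈ C.charts) {p : Eu m} {q : Eu n} (hp : p ∈ unitCube m)
    (hq : q ∈ unitCube n) (he : c q = f p) (hlt : ∀ E, crd f κ p E < 1) :
    ∃ κ', CC C v c κ' := by
  obtain ⟨k, g, hg, ⟨F⟩, ⟨F'⟩, him⟩ := inter h.mem hc (x := f p) ⟨p, hp, rfl⟩ ⟨q, hq, he⟩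
  have hx : f p ∈ g '' unitCube k := by rw [him]; exact ⟨⟨p, hp, rfl⟩, ⟨q, hq, he⟩⟩
  obtain ⟨r, hr, hrx⟩ := hx
  have hrp : F.i r = p := h.inj (F.mem_cube hr) hp (by rw [← hrx, F.ap])
  have hκ : F.i (F.pb κ) = κ := by
    apply F.i_pb
    intro l hl
    have h1 := hlt (cornerEdge f κ l)
    rw [h.crd_edge, ← hrp, F.hi' _ l hl, abs_lt] at h1
    rcases F.hb l with hb | hb <;> rcases h.cor l with hk | hk <;> rw [hb, hk] at h1 ⊢ <;>
      norm_num at h1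
  refine ⟨F'.i (F.pb κ), hc, F'.i_corner (F.pb_corner h.cor), ?_⟩
  have e1 : g (F.pb κ) = f (F.i (F.pb κ)) := F.ap _
  have e2 : g (F.pb κ) = c (F'.i (F.pb κ)) := F'.ap _
  rw [← e2, e1, hκ, h.eq]

theorem CC.face {n : ℕ} {f : Eu (n + 1) → X} {κ : Eu (n + 1)} (h : CC C v f κ) (i : Fin (n + 1)) :
    ∃ (g : Eu n → X) (κ' : Eu n), CC C v g κ' ∧
      ∀ j, cornerEdge g κ' j = cornerEdge f κ (i.succAbove j) := by
  let F : Fc (f ∘ faceMap i (κ i)) f := ⟨i.succAbove, Fin.succAbove_right_injective,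
    fun j => κ j, h.cor, faceMap i (κ i), faceMap_succAbove i (κ i), by
      intro x l
      refine Fin.succAboveCases i ?_ (fun j => ?_) l
      · intro _; rw [faceMap_same]
      · intro hj; exact absurd ⟨j, rfl⟩ hj, rfl⟩
  have hκ : F.i (F.pb κ) = κ := F.i_pb fun l _ => rfl
  refine ⟨f ∘ faceMap i (κ i), F.pb κ, ⟨C.closed_faces n f h.mem i _ (h.cor i),
    F.pb_corner h.cor, ?_⟩, ?_⟩
  · change f (F.i (F.pb κ)) = v
    rw [hκ, h.eq]
  · intro j
    rw [F.edge, hκ]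

theorem CC.isVertex {n : ℕ} {f : Eu n → X} {κ : Eu n} (h : CC C v f κ) : C.IsVertex v := by
  induction n with
  | zero => exact ⟨f, h.mem, κ, h.eq⟩
  | succ n ih =>
    obtain ⟨g, κ', h', _⟩ := h.face 0
    exact ih h'

theorem CC.sub_simplex {n : ℕ} {f : Eu n → X} {κ : Eu n} (h : CC C v f κ) {S : Set (Set X)}
    (hS : S.Nonempty) (hs : S ⊆ Set.range (cornerEdge f κ)) : S ∈ C.LinkSimplices v := by
  induction n with
  | zero =>
    obtain ⟨E, hE⟩ := hS
    obtain ⟨i, _⟩ := hs hE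
    exact i.elim0
  | succ n ih =>
    by_cases heq : Set.range (cornerEdge f κ) ⊆ S
    · exact ⟨n + 1, f, κ, by omega, h.mem, h.cor, h.eq, hs.antisymm heq⟩
    · rw [Set.not_subset] at heq
      obtain ⟨_, ⟨i, rfl⟩, hi⟩ := heq
      obtain ⟨g, κ', h', he⟩ := h.face i
      refine ih h' fun E hE => ?_
      obtain ⟨l, rfl⟩ := hs hE
      have hl : l ≠ i := by rintro rfl; exact hi hE
      obtain ⟨j, rfl⟩ := Fin.exists_succAbove_eq hl
      exact ⟨j, he j⟩

theorem simplex_CC {S : Set (Set X)} (h : S ∈ C.LinkSimplices v) :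
    ∃ (n : ℕ) (f : Eu n → X) (κ : Eu n), CC C v f κ ∧ Set.range (cornerEdge f κ) = S := by
  obtain ⟨n, f, κ, _, h1, h2, h3, h4⟩ := h
  exact ⟨n, f, κ, ⟨h1, h2, h3⟩, h4.symm⟩

theorem edge_of_singleton {E : Set X} (h : {E} ∈ C.LinkSimplices v) : E ∈ C.EdgesAt v := by
  obtain ⟨n, f, κ, h0, h1, h2, h3, h4⟩ := h
  have hcc : CC C v f κ := ⟨h1, h2, h3⟩
  have hn : n = 1 := by
    by_contra hne
    have hE : ∀ i, cornerEdge f κ i = E := fun i => by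
      have : cornerEdge f κ i ∈ ({E} : Set (Set X)) := by rw [h4]; exact ⟨i, rfl⟩
      simpa using this
    have := hcc.edge_inj ((hE ⟨0, by omega⟩).trans (hE ⟨1, by omega⟩).symm)
    simp at this
  subst hn
  refine ⟨f, h1, ?_, κ, h2, h3⟩
  have : cornerEdge f κ 0 ∈ ({E} : Set (Set X)) := by rw [h4]; exact ⟨0, rfl⟩
  have h5 : cornerEdge f κ 0 = E := by simpa using this
  rw [← h5, cornerEdge]
  congr 1
  ext x
  constructor
  · exact fun h => h.1
  · exact fun h => ⟨h, fun j hj => absurd (Subsingleton.elim j 0) hj⟩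

theorem singleton_of_edge {E : Set X} (h : E ∈ C.EdgesAt v) : {E} ∈ C.LinkSimplices v := by
  obtain ⟨f, h1, h2, κ, h3, h4⟩ := h
  refine ⟨1, f, κ, le_rfl, h1, h3, h4, ?_⟩
  have h5 : ∀ i, cornerEdge f κ i = E := by
    intro i
    rw [h2, cornerEdge]
    congr 1
    ext x
    constructor
    · exact fun h => h.1
    · exact fun h => ⟨h, fun j hj => absurd (Subsingleton.elim j i) hj⟩
  ext F
  constructor
  · rintro rfl; exact ⟨0, h5 0⟩
  · rintro ⟨i, rfl⟩; exact h5 i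

end Cubes
end GLC


namespace GLC

section Tri

theorem two_le_of_inner {E : Type*} [NormedAddCommGroup E] [InnerProductSpace ℝ E] (q p a b : E)
    (M : ℝ) (hM : 0 < M) (h1 : ‖q - b‖ = M) (h2 : ‖b - p‖ = M)
    (h3 : inner ℝ (a - b) ((b - p) - (q - b)) = 0) : 2 * M ≤ dist q a + dist a p := by
  have e1 := real_inner_le_norm (q - a) (q - b)
  have e2 := real_inner_le_norm (a - p) (b - p)
  rw [h1] at e1
  rw [h2] at e2
  have e3 : inner ℝ (q - a) (q - b) + inner ℝ (a - p) (b - p) = 2 * M ^ 2 := by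
    have a1 : q - a = (q - b) - (a - b) := by abel
    have a2 : a - p = (b - p) + (a - b) := by abel
    rw [a1, a2, inner_sub_left, inner_add_left, real_inner_self_eq_norm_sq,
      real_inner_self_eq_norm_sq, h1, h2]
    rw [inner_sub_right] at h3
    linarith
  rw [dist_eq_norm, dist_eq_norm]
  have : M * (2 * M) ≤ M * (‖q - a‖ + ‖a - p‖) := by nlinarith
  exact le_of_mul_le_mul_left this hM

variable {ι : Type*} [Fintype ι]

theorem OChain.hit {K : Set (Set ι)} (hK : Set.univ ∉ K) {i1 : ι}
    {a b : EuclideanSpace ℝ ι} {r : ℝ} (h : OChain K a b r) (ha : a i1 ≠ 0) (hb : b i1 = 0) :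
    ∃ c : EuclideanSpace ℝ ι, c i1 = 0 ∧ (∃ j, j ≠ i1 ∧ c j = 0) ∧ dist a c + dist c b ≤ r := by
  induction h with
  | refl a => exact absurd hb ha
  | @step a m b s hs hc ih =>
    by_cases hm : m i1 = 0
    · obtain ⟨_, _, σ, h3, h4, h5⟩ := hs
      have hne : ∃ j, j ∉ σ := by
        by_contra hcon
        push Not at hcon
        exact hK ((Set.eq_univ_of_forall hcon) ▸ h3)
      obtain ⟨j, hj⟩ := hne
      refine ⟨m, hm, ⟨j, ?_, ?_⟩, ?_⟩
      · rintro rfl; exact hj (h4 ha)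
      · by_contra hcon; exact hj (h5 hcon)
      · linarith [hc.le]
    · obtain ⟨c, h1, h2, h3⟩ := ih hm hb
      exact ⟨c, h1, h2, by linarith [dist_triangle a m c]⟩

open Classical in
noncomputable def vq (δ : ℝ) (i1 : ι) : EuclideanSpace ℝ ι :=
  WithLp.toLp 2 fun i => if i = i1 then δ else 0

open Classical in
noncomputable def vp (δ : ℝ) (i1 : ι) : EuclideanSpace ℝ ι :=
  WithLp.toLp 2 fun i => if i = i1 then 0 else δ

open Classical in
noncomputable def va (δ : ℝ) (i1 j : ι) : EuclideanSpace ℝ ι :=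
  WithLp.toLp 2 fun i => if i = i1 then 0 else if i = j then 0 else δ / 2

theorem norm_q_a (δ : ℝ) {i1 j : ι} (hj : j ≠ i1) :
    ‖vq δ i1 - va δ i1 j‖ ^ 2 = Fintype.card ι * (δ ^ 2 / 4) + δ ^ 2 / 2 := by
  classical
  rw [EuclideanSpace.norm_sq_eq]
  have : ∀ i, ‖(vq δ i1 - va δ i1 j) i‖ ^ 2 = δ ^ 2 / 4 + (if i = i1 then 3 * δ ^ 2 / 4 else 0) +
      (if i = j then - δ ^ 2 / 4 else 0) := by
    intro i
    rw [Real.norm_eq_abs, sq_abs]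
    simp only [vq, va, PiLp.sub_apply]
    by_cases h1 : i = i1
    · subst h1; simp [hj.symm]; ring
    · by_cases h2 : i = j
      · subst h2; simp [h1]; ring
      · simp [h1, h2]; ring
  simp only [this, Finset.sum_add_distrib, Finset.sum_ite_eq', Finset.sum_const, Finset.mem_univ,
    if_true, nsmul_eq_mul, Finset.card_univ]
  ring

theorem norm_a_p (δ : ℝ) {i1 j : ι} (hj : j ≠ i1) :
    ‖va δ i1 j - vp δ i1‖ ^ 2 = Fintype.card ι * (δ ^ 2 / 4) + δ ^ 2 / 2 := by
  classical
  rw [EuclideanSpace.norm_sq_eq]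
  have : ∀ i, ‖(va δ i1 j - vp δ i1) i‖ ^ 2 = δ ^ 2 / 4 + (if i = i1 then - δ ^ 2 / 4 else 0) +
      (if i = j then 3 * δ ^ 2 / 4 else 0) := by
    intro i
    rw [Real.norm_eq_abs, sq_abs]
    simp only [vp, va, PiLp.sub_apply]
    by_cases h1 : i = i1
    · subst h1; simp [hj.symm]; ring
    · by_cases h2 : i = j
      · subst h2; simp [h1]; ring
      · simp [h1, h2]; ring
  simp only [this, Finset.sum_add_distrib, Finset.sum_ite_eq', Finset.sum_const, Finset.mem_univ,
    if_true, nsmul_eq_mul, Finset.card_univ]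
  ring

theorem inner_a (δ : ℝ) {i1 j : ι} (a : EuclideanSpace ℝ ι) (h1 : a i1 = 0) (h2 : a j = 0) :
    inner ℝ (a - va δ i1 j) ((va δ i1 j - vp δ i1) - (vq δ i1 - va δ i1 j)) = 0 := by
  classical
  rw [PiLp.inner_apply]
  apply Finset.sum_eq_zero
  intro i _
  by_cases hi : i = i1
  · subst hi; simp [va, h1]
  · by_cases hi' : i = j
    · subst hi'; simp [va, h2]
    · simp [va, vp, vq, hi, hi']; left; ring

theorem norm_le_card {x : EuclideanSpace ℝ ι} {η : ℝ} (hη : 0 < η) (hc : 0 < Fintype.card ι)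
    (h : ∀ i, |x i| ≤ η / Fintype.card ι) : ‖x‖ ≤ η := by
  have hc1 : (1 : ℝ) ≤ Fintype.card ι := by exact_mod_cast hc
  apply abs_le_of_sq_le_sq' _ hη.le |>.2
  rw [EuclideanSpace.norm_sq_eq]
  have : ∀ i ∈ Finset.univ, ‖x i‖ ^ 2 ≤ (η / Fintype.card ι) ^ 2 := by
    intro i _
    rw [Real.norm_eq_abs]
    exact pow_le_pow_left₀ (abs_nonneg _) (h i) 2
  refine (Finset.sum_le_sum this).trans ?_
  rw [Finset.sum_const, nsmul_eq_mul, Finset.card_univ, div_pow]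
  rw [mul_div_assoc', div_le_iff₀ (by positivity)]
  nlinarith [sq_nonneg η, mul_nonneg (sq_nonneg η) (by linarith : (0:ℝ) ≤ Fintype.card ι)]

/-- bigons in the orthant space over the boundary of a simplex -/
theorem bigon {K : Set (Set ι)} (hK : ∀ σ, σ ∈ K ↔ σ ≠ Set.univ) {i1 i2 i3 : ι} (h12 : i2 ≠ i1)
    (h13 : i3 ≠ i1) (h23 : i2 ≠ i3) {η : ℝ} (hη : 0 < η) :
    ∃ q p a b : Orth K, ‖q.val‖ ≤ η ∧ ‖p.val‖ ≤ η ∧ ‖a.val‖ ≤ η ∧ ‖b.val‖ ≤ η ∧ a ≠ b ∧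
      dist q a = dist q p / 2 ∧ dist p a = dist q p / 2 ∧
      dist q b = dist q p / 2 ∧ dist p b = dist q p / 2 := by
  classical
  have hcard : 0 < Fintype.card ι := Fintype.card_pos_iff.2 ⟨i1⟩
  have hcard' : (0 : ℝ) < Fintype.card ι := by exact_mod_cast hcard
  set δ : ℝ := η / Fintype.card ι with hδ
  have hδ0 : 0 < δ := by positivity
  have mk : ∀ (x : EuclideanSpace ℝ ι) (i : ι), x i = 0 → sp x ∈ K := fun x i hi =>
    (hK _).2 fun h => (by rw [h]; trivial : i ∈ sp x) hi
  let q : Orth K := ⟨vq δ i1, fun i => by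
    change 0 ≤ (if i = i1 then δ else 0); split_ifs <;> linarith, mk _ i2 (by simp [vq, h12])⟩
  let p : Orth K := ⟨vp δ i1, fun i => by
    change 0 ≤ (if i = i1 then 0 else δ); split_ifs <;> linarith, mk _ i1 (by simp [vp])⟩
  let a : ι → Orth K := fun j => ⟨va δ i1 j, fun i => by
    change 0 ≤ (if i = i1 then 0 else if i = j then 0 else δ / 2); split_ifs <;> linarith,
    mk _ i1 (by simp [va])⟩
  have hMpos : 0 < Fintype.card ι * (δ ^ 2 / 4) + δ ^ 2 / 2 := by positivity
  set M : ℝ := √(Fintype.card ι * (δ ^ 2 / 4) + δ ^ 2 / 2) with hM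
  have hM0 : 0 < M := Real.sqrt_pos.2 hMpos
  have n1 : ∀ j, j ≠ i1 → ‖vq δ i1 - va δ i1 j‖ = M := fun j hj => by
    rw [hM, ← norm_q_a δ hj, Real.sqrt_sq (norm_nonneg _)]
  have n2 : ∀ j, j ≠ i1 → ‖va δ i1 j - vp δ i1‖ = M := fun j hj => by
    rw [hM, ← norm_a_p δ hj, Real.sqrt_sq (norm_nonneg _)]
  have d1 : ∀ j, j ≠ i1 → dist q (a j) = M := by
    intro j hj
    rw [Orth.dist_eq_of_step ⟨q.nonneg, (a j).nonneg, {j}ᶜ, (hK _).2 (by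
      intro h; have : j ∈ ({j}ᶜ : Set ι) := by rw [h]; trivial
      exact this rfl), ?_, ?_⟩, dist_eq_norm]
    · exact n1 j hj
    · rintro i hi rfl; exact hi (by simp [q, vq, hj])
    · rintro i hi rfl; exact hi (by simp [a, va])
  have d2 : ∀ j, j ≠ i1 → dist (a j) p = M := by
    intro j hj
    rw [Orth.dist_eq_of_step ⟨(a j).nonneg, p.nonneg, {i1}ᶜ, (hK _).2 (by
      intro h; have : i1 ∈ ({i1}ᶜ : Set ι) := by rw [h]; trivial
      exact this rfl), ?_, ?_⟩, dist_eq_norm]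
    · exact n2 j hj
    · rintro i hi rfl; exact hi (by simp [a, va])
    · rintro i hi rfl; exact hi (by simp [p, vp])
  have d3 : dist q p = 2 * M := by
    apply le_antisymm
    · have := dist_triangle q (a i2) p
      rw [d1 i2 h12, d2 i2 h12] at this; linarith
    · by_contra hlt
      push Not at hlt
      obtain ⟨r, hr, hc⟩ := Orth.exists_chain_lt hlt
      obtain ⟨c, c1, ⟨j, hj, c2⟩, c3⟩ := hc.hit (fun h => (hK _).1 h rfl) (i1 := i1)
        (by simp [q, vq]; exact hδ0.ne') (by simp [p, vp])
      have := two_le_of_inner (vq δ i1) (vp δ i1) c (va δ i1 j) M hM0 (n1 j hj) (n2 j hj)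
        (inner_a δ c c1 c2)
      change dist (vq δ i1) c + dist c (vp δ i1) ≤ r at c3
      linarith
  refine ⟨q, p, a i2, a i3, ?_, ?_, ?_, ?_, ?_, ?_, ?_, ?_, ?_⟩
  · refine norm_le_card hη hcard fun i => ?_
    change |if i = i1 then δ else 0| ≤ δ
    split_ifs <;> simp [abs_of_pos hδ0, hδ0.le]
  · refine norm_le_card hη hcard fun i => ?_
    change |if i = i1 then 0 else δ| ≤ δ
    split_ifs <;> simp [abs_of_pos hδ0, hδ0.le]
  · refine norm_le_card hη hcard fun i => ?_
    change |if i = i1 then 0 else if i = i2 then 0 else δ / 2| ≤ δ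
    split_ifs
    · simpa using hδ0.le
    · simpa using hδ0.le
    · rw [abs_of_pos (by positivity)]; linarith
  · refine norm_le_card hη hcard fun i => ?_
    change |if i = i1 then 0 else if i = i3 then 0 else δ / 2| ≤ δ
    split_ifs
    · simpa using hδ0.le
    · simpa using hδ0.le
    · rw [abs_of_pos (by positivity)]; linarith
  · intro h
    have h' : va δ i1 i2 i2 = va δ i1 i3 i2 := by
      have := congrArg Orth.val h
      change va δ i1 i2 = va δ i1 i3 at this
      rw [this]
    simp [va, h12, h23] at h'
    linarith
  · rw [d1 i2 h12, d3]; ring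
  · rw [dist_comm, d2 i2 h12, d3]; ring
  · rw [d1 i3 h13, d3]; ring
  · rw [dist_comm, d2 i3 h13, d3]; ring

end Tri
end GLC


namespace GLC

section Loc
variable {X : Type*} [MetricSpace X]

/-- `u` is the coordinate function of `x` near `v` -/
def Rel (C : CubeComplex X) (v x : X) (u : Set X → ℝ) : Prop :=
  ∃ (n : ℕ) (f : Eu n → X) (κ : Eu n), CC C v f κ ∧ ∃ p ∈ unitCube n, f p = x ∧ crd f κ p = u

/-- `E` is an edge of a cube at the corner `v` -/
def IsE (C : CubeComplex X) (v : X) (E : Set X) : Prop :=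
  ∃ (n : ℕ) (f : Eu n → X) (κ : Eu n), CC C v f κ ∧ E ∈ Set.range (cornerEdge f κ)

/-- the link on the finite set `W` -/
def KW (C : CubeComplex X) (v : X) (W : Finset (Set X)) : Set (Set W) :=
  {σ | ∃ (n : ℕ) (f : Eu n → X) (κ : Eu n), CC C v f κ ∧
    ∀ E ∈ σ, (E : Set X) ∈ Set.range (cornerEdge f κ)}

noncomputable def res (W : Finset (Set X)) (u : Set X → ℝ) : EuclideanSpace ℝ W :=
  WithLp.toLp 2 fun E => u E

open Classical in
noncomputable def ex (W : Finset (Set X)) (w : EuclideanSpace ℝ W) : Set X → ℝ :=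
  fun E => if h : E ∈ W then w ⟨E, h⟩ else 0

variable {C : CubeComplex X} {v : X} {W : Finset (Set X)}

theorem ex_mem (w : EuclideanSpace ℝ W) (E : W) : ex W w E = w E := by
  simp [ex]

theorem ex_not_mem (w : EuclideanSpace ℝ W) {E : Set X} (h : E ∉ W) : ex W w E = 0 := by
  simp [ex, h]

theorem res_ex (w : EuclideanSpace ℝ W) : res W (ex W w) = w := by
  ext E; exact ex_mem w E

theorem ex_res {u : Set X → ℝ} (h : ∀ E, u E ≠ 0 → E ∈ W) : ex W (res W u) = u := by
  ext E
  by_cases hE : E ∈ W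
  · exact ex_mem _ ⟨E, hE⟩
  · rw [ex_not_mem _ hE]
    by_contra hne
    exact hE (h E (Ne.symm hne))

theorem Rel.fn {x : X} {u u' : Set X → ℝ} (h : Rel C v x u) (h' : Rel C v x u') : u = u' := by
  obtain ⟨n, f, κ, h1, p, h2, h3, rfl⟩ := h
  obtain ⟨n', f', κ', h1', p', h2', h3', rfl⟩ := h'
  exact crd_unique h1 h1' h2 h2' (h3.trans h3'.symm)

theorem Rel.lift {x : X} {u : Set X → ℝ} (h : Rel C v x u) {n : ℕ} {f : Eu n → X} {κ : Eu n}
    (hf : CC C v f κ) (hs : ∀ E, u E ≠ 0 → E ∈ Set.range (cornerEdge f κ)) :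
    ∃ p ∈ unitCube n, f p = x ∧ crd f κ p = u := by
  obtain ⟨n', f', κ', h1, p', h2, h3, rfl⟩ := h
  obtain ⟨q, hq, hq'⟩ := mem_of_supp h1 hf h2 hs
  exact ⟨q, hq, hq'.trans h3, crd_unique hf h1 hq h2 hq'⟩

theorem Rel.inj {x y : X} {u : Set X → ℝ} (h : Rel C v x u) (h' : Rel C v y u) : x = y := by
  obtain ⟨n, f, κ, h1, p, h2, h3, rfl⟩ := h
  obtain ⟨q, hq, hq', he⟩ := h'.lift h1 (fun E hE => by
    by_contra hc; exact hE (crd_ne _ _ _ hc))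
  rw [← h3, ← hq', h1.crd_inj hq h2 he]

theorem Rel.nonneg {x : X} {u : Set X → ℝ} (h : Rel C v x u) (E : Set X) : 0 ≤ u E := by
  obtain ⟨n, f, κ, h1, p, h2, h3, rfl⟩ := h
  exact crd_nonneg _ _ _ _

theorem Rel.supp {x : X} {u : Set X → ℝ} (h : Rel C v x u) :
    ∃ T : Finset (Set X), (∀ E ∈ T, IsE C v E) ∧ ∀ E, u E ≠ 0 → E ∈ T := by
  classical
  obtain ⟨n, f, κ, h1, p, h2, h3, rfl⟩ := h
  refine ⟨Finset.univ.image (cornerEdge f κ), ?_, ?_⟩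
  · intro E hE
    exact ⟨n, f, κ, h1, by simpa using hE⟩
  · intro E hE
    by_contra hc
    exact hE (crd_ne _ _ _ (by simpa using hc))

theorem Rel.mem_KW {x : X} {u : Set X → ℝ} (h : Rel C v x u) : sp (res W u) ∈ KW C v W := by
  obtain ⟨n, f, κ, h1, p, h2, h3, rfl⟩ := h
  refine ⟨n, f, κ, h1, ?_⟩
  intro E hE
  by_contra hc
  exact hE (crd_ne _ _ _ hc)

theorem sum_le_of_zero {α : Type*} {s t : Finset α} (g : α → ℝ) (h0 : ∀ x, 0 ≤ g x)
    (h : ∀ x ∈ s, g x ≠ 0 → x ∈ t) : ∑ x ∈ s, g x ≤ ∑ x ∈ t, g x := by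
  classical
  rw [← Finset.sum_filter_ne_zero s]
  apply Finset.sum_le_sum_of_subset_of_nonneg
  · intro x hx
    rw [Finset.mem_filter] at hx
    exact h x hx.1 hx.2
  · exact fun _ _ _ => h0 _

theorem sum_edges {n : ℕ} {f : Eu n → X} {κ : Eu n} (h : CC C v f κ) {p q : Eu n}
    (hp : p ∈ unitCube n) (hq : q ∈ unitCube n) :
    dist (res W (crd f κ p)) (res W (crd f κ q)) ≤ dist p q ∧
    ((∀ E, E ∉ W → crd f κ p E = 0) → (∀ E, E ∉ W → crd f κ q E = 0) →
    dist p q = dist (res W (crd f κ p)) (res W (crd f κ q))) := by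
  classical
  set g : Set X → ℝ := fun E => dist (crd f κ p E) (crd f κ q E) ^ 2 with hg
  have e1 : dist (res W (crd f κ p)) (res W (crd f κ q)) = √(∑ E ∈ W, g E) := by
    rw [EuclideanSpace.dist_eq, ← Finset.sum_coe_sort W g]
    rfl
  have e2 : dist p q = √(∑ E ∈ Finset.univ.image (cornerEdge f κ), g E) := by
    rw [EuclideanSpace.dist_eq, Finset.sum_image (fun _ _ _ _ h' => h.edge_inj h')]
    congr 1
    apply Finset.sum_congr rfl
    intro i _
    rw [hg]
    dsimp only
    rw [h.crd_edge, h.crd_edge, Real.dist_eq, Real.dist_eq, abs_sub_abs_corner h.cor hp hq]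
  have hz : ∀ E, E ∉ Finset.univ.image (cornerEdge f κ) → g E = 0 := by
    intro E hE
    have hE' : E ∉ Set.range (cornerEdge f κ) := by simpa using hE
    simp [hg, crd_ne _ _ _ hE']
  have hle : ∑ E ∈ W, g E ≤ ∑ E ∈ Finset.univ.image (cornerEdge f κ), g E := by
    apply sum_le_of_zero g (fun _ => sq_nonneg _)
    intro E _ hE
    by_contra hc
    exact hE (hz E hc)
  refine ⟨by rw [e1, e2]; exact Real.sqrt_le_sqrt hle, fun hp0 hq0 => ?_⟩
  rw [e1, e2]
  congr 1
  refine le_antisymm ?_ hle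
  apply sum_le_of_zero g (fun _ => sq_nonneg _)
  intro E _ hE
  by_contra hc
  exact hE (by simp [hg, hp0 E hc, hq0 E hc])

theorem chain_nonneg {y z : X} {r : ℝ} (h : Chain C.toPreCubeComplex y z r) : 0 ≤ r := by
  induction h with
  | refl => exact le_rfl
  | step hs _ ih =>
    obtain ⟨c, _, p, _, q, _, _, _, rfl⟩ := hs
    have := dist_nonneg (x := p) (y := q)
    linarith

theorem exists_chain_lt {y z : X} {r : ℝ} (h : dist y z < r) :
    ∃ r' < r, Chain C.toPreCubeComplex y z r' := by
  have hne : {r : ℝ | Chain C.toPreCubeComplex y z r}.Nonempty := by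
    by_contra hc
    rw [Set.not_nonempty_iff_eq_empty] at hc
    have h1 := C.dist_eq y z
    rw [hc, Real.sInf_empty] at h1
    have h2 := dist_eq_zero.1 h1
    subst h2
    have : (0 : ℝ) ∈ {r : ℝ | Chain C.toPreCubeComplex y y r} := Chain.refl y
    rw [hc] at this
    exact this
  rw [C.dist_eq] at h
  obtain ⟨r', h1, h2⟩ := exists_lt_of_csInf_lt hne h
  exact ⟨r', h2, h1⟩

/-- chains in `X` give chains in the orthant space -/
theorem chain_down (W : Finset (Set X)) {y z : X} {r : ℝ} (h : Chain C.toPreCubeComplex y z r) :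
    ∀ u, Rel C v y u → (∀ E, u E + r < 1) → ∃ u', Rel C v z u' ∧ (∀ E, u' E ≤ u E + r) ∧
      ∃ r' ≤ r, OChain (KW C v W) (res W u) (res W u') r' := by
  induction h with
  | refl a => exact fun u hu _ => ⟨u, hu, fun E => by linarith, 0, le_rfl, OChain.refl _⟩
  | @step a b c r s hs hc ih =>
    intro u hu hlt
    obtain ⟨⟨n, c'⟩, hc', p, hp, q, hq, hpa, hqb, rfl⟩ := hs
    change c' p = a at hpa
    change c' q = b at hqb
    change p ∈ unitCube n at hp
    change q ∈ unitCube n at hq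
    have hs0 := chain_nonneg hc
    have hu' := hu
    obtain ⟨n', f, κ, h1, p', h2, h3, rfl⟩ := hu
    obtain ⟨κ', hκ'⟩ := h1.of_lt_one hc' h2 hp (hpa.trans h3.symm) (fun E => by
      have := hlt E
      have := dist_nonneg (x := p) (y := q)
      linarith)
    have e1 : crd c' κ' p = crd f κ p' := crd_unique hκ' h1 hp h2 (hpa.trans h3.symm)
    rw [← e1] at hlt ⊢
    have hb : Rel C v b (crd c' κ' q) := ⟨n, c', κ', hκ', q, hq, hqb, rfl⟩
    have hle : ∀ E, crd c' κ' q E ≤ crd c' κ' p E + dist p q := by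
      intro E
      by_cases hE : E ∈ Set.range (cornerEdge c' κ')
      · obtain ⟨i, rfl⟩ := hE
        rw [hκ'.crd_edge, hκ'.crd_edge]
        have t1 := abs_sub_abs_corner hκ'.cor hp hq i
        have t2 := coord_le p q i
        have t3 := neg_abs_le (|p i - κ' i| - |q i - κ' i|)
        linarith
      · rw [crd_ne _ _ _ hE, crd_ne _ _ _ hE]
        have := dist_nonneg (x := p) (y := q)
        linarith
    obtain ⟨u', k1, k2, r', k3, k4⟩ := ih _ hb (fun E => by
      have := hle E; have := hlt E; dsimp only at *; linarith)
    refine ⟨u', k1, fun E => by have := k2 E; have := hle E; dsimp only at *; linarith, _,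
      add_le_add (sum_edges (W := W) hκ' hp hq).1 k3, OChain.step ⟨?_, ?_, ?_⟩ k4⟩
    · exact fun i => crd_nonneg _ _ _ _
    · exact fun i => crd_nonneg _ _ _ _
    · refine ⟨{E | (E : Set X) ∈ Set.range (cornerEdge c' κ')}, ⟨n, c', κ', hκ', fun E hE => hE⟩,
        ?_, ?_⟩
      · intro E hE
        by_contra hcon
        exact hE (crd_ne _ _ _ hcon)
      · intro E hE
        by_contra hcon
        exact hE (crd_ne _ _ _ hcon)

theorem OChain.nonneg {ι : Type*} [Fintype ι] {K : Set (Set ι)} {a b : EuclideanSpace ℝ ι} {r : ℝ}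
    (h : OChain K a b r) : 0 ≤ r := dist_nonneg.trans h.le

/-- chains in the orthant space give chains in `X` -/
theorem chain_up {w w' : EuclideanSpace ℝ W} {r : ℝ} (h : OChain (KW C v W) w w' r) :
    ∀ y, Rel C v y (ex W w) → (∀ E, w E + r < 1) →
      ∃ z, Rel C v z (ex W w') ∧ dist y z ≤ r := by
  induction h with
  | refl a => exact fun y hy _ => ⟨y, hy, by simp⟩
  | @step a b c s hs hc ih =>
    intro y hy hlt
    have hs0 := hc.nonneg
    obtain ⟨ha, hb, σ, ⟨n, f, κ, hf, hσ⟩, h4, h5⟩ := hs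
    have sup : ∀ w : EuclideanSpace ℝ W, sp w ⊆ σ → ∀ E, ex W w E ≠ 0 →
        E ∈ Set.range (cornerEdge f κ) := by
      intro w hw E hE
      by_cases hEW : E ∈ W
      · apply hσ ⟨E, hEW⟩ (hw _)
        intro h0
        rw [← ex_mem] at h0
        exact hE h0
      · exact absurd (ex_not_mem w hEW) hE
    have hble : ∀ E : W, b E ≤ a E + dist a b := by
      intro E
      have t2 := coord_le a b E
      have t3 := neg_abs_le (a E - b E)
      linarith
    obtain ⟨p, hp, hpy, hpc⟩ := hy.lift hf (sup a h4)
    obtain ⟨q, hq, hqc⟩ := hf.exists_crd (ex W b) (fun E => by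
        by_cases hEW : E ∈ W
        · rw [ex_mem b ⟨E, hEW⟩]; exact hb _
        · rw [ex_not_mem b hEW]) (fun E => by
        by_cases hEW : E ∈ W
        · rw [ex_mem b ⟨E, hEW⟩]
          have := hble ⟨E, hEW⟩
          have := hlt ⟨E, hEW⟩
          linarith
        · rw [ex_not_mem b hEW]; exact zero_le_one) (sup b h5)
    obtain ⟨z, hz, hd⟩ := ih (f q) ⟨n, f, κ, hf, q, hq, rfl, hqc⟩ (fun E => by
      have := hble E; have := hlt E; linarith)
    refine ⟨z, hz, ?_⟩
    have e := (sum_edges (W := W) hf hp hq).2 (fun E hE => by rw [hpc, ex_not_mem _ hE])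
      (fun E hE => by rw [hqc, ex_not_mem _ hE])
    rw [hpc, hqc, res_ex, res_ex] at e
    have e2 : dist (f p) (f q) ≤ dist p q := C.short _ hf.mem p hp q hq
    rw [hpy, e] at e2
    linarith [dist_triangle y (f q) z]

theorem ex_le {w : EuclideanSpace ℝ W} {t : ℝ} (ht : 0 ≤ t) (h : ∀ E, w E ≤ t) (E : Set X) :
    ex W w E ≤ t := by
  by_cases hEW : E ∈ W
  · rw [ex_mem w ⟨E, hEW⟩]; exact h _
  · rw [ex_not_mem w hEW]; exact ht

/-- lifting points of the orthant space -/
theorem lift_pt {a b : Orth (KW C v W)} {x : X} {c : ℝ} (hx : Rel C v x (ex W a.val))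
    (hc : ∀ E, ex W a.val E + c ≤ 1) (hd : dist a b < c) :
    ∃ z, Rel C v z (ex W b.val) ∧ dist x z ≤ dist a b := by
  have key : ∀ r, dist a b < r → r ≤ c → ∃ z, Rel C v z (ex W b.val) ∧ dist x z ≤ r := by
    intro r h1 h2
    obtain ⟨r', h3, h4⟩ := Orth.exists_chain_lt h1
    obtain ⟨z, h5, h6⟩ := chain_up h4 x hx (fun E => by
      have := hc E; rw [ex_mem] at this; linarith)
    exact ⟨z, h5, by linarith⟩
  obtain ⟨z, hz, _⟩ := key c hd le_rfl
  refine ⟨z, hz, le_of_forall_pos_le_add fun ε hε => ?_⟩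
  obtain ⟨z', hz', h'⟩ := key (min c (dist a b + ε)) (lt_min hd (by linarith)) (min_le_left _ _)
  rw [hz.inj hz']
  exact h'.trans (min_le_right _ _)

theorem iso {a b : Orth (KW C v W)} {x y : X} {c : ℝ} (hx : Rel C v x (ex W a.val))
    (hy : Rel C v y (ex W b.val))
    (hc : ∀ E, ex W a.val E + c ≤ 1) (hd : dist x y < c) : dist a b = dist x y := by
  have key : ∀ r, dist x y < r → r ≤ c → dist a b ≤ r := by
    intro r h1 h2
    obtain ⟨r', h3, h4⟩ := exists_chain_lt (C := C) h1
    obtain ⟨u', k1, _, r'', k2, k3⟩ := chain_down W h4 _ hx (fun E => by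
      have := hc E; linarith)
    rw [k1.fn hy, res_ex, res_ex] at k3
    have := Orth.dist_le k3
    linarith
  have h1 : dist a b ≤ dist x y := le_of_forall_pos_le_add fun ε hε =>
    (key (min c (dist x y + ε)) (lt_min hd (by linarith)) (min_le_left _ _)).trans
      (min_le_right _ _)
  refine le_antisymm h1 ?_
  obtain ⟨z, hz, hz'⟩ := lift_pt (b := b) hx hc (h1.trans_lt hd)
  rwa [hz.inj hy] at hz'

theorem near {x y : X} {u : Set X → ℝ} {c : ℝ} (hx : Rel C v x u) (hc : ∀ E, u E + c ≤ 1)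
    (hd : dist x y < c) : ∃ u', Rel C v y u' ∧ ∀ E, u' E ≤ u E + c := by
  obtain ⟨r', h3, h4⟩ := exists_chain_lt (C := C) hd
  obtain ⟨u', k1, k2, _⟩ := chain_down ∅ h4 _ hx (fun E => by have := hc E; linarith)
  exact ⟨u', k1, fun E => by have := k2 E; linarith⟩

/-- the point of the orthant space -/
noncomputable def Rel.pt {x : X} {u : Set X → ℝ} (h : Rel C v x u) (W : Finset (Set X)) :
    Orth (KW C v W) := ⟨res W u, fun E => h.nonneg E, h.mem_KW⟩

theorem Rel.pt_val {x : X} {u : Set X → ℝ} (h : Rel C v x u)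
    (hW : ∀ E, u E ≠ 0 → E ∈ W) : ex W (h.pt W).val = u := ex_res hW

theorem isC_KW (hfl : C.LinkFlag v) (hW : ∀ E ∈ W, IsE C v E)
    (h0 : ∃ (n : ℕ) (f : Eu n → X) (κ : Eu n), CC C v f κ) :
    IsC (Set.univ : Set (Orth (KW C v W))) := by
  apply isC_univ
  · rintro σ ⟨n, f, κ, h1, h2⟩ τ hτ
    exact ⟨n, f, κ, h1, fun E hE => h2 E (hτ hE)⟩
  · intro i
    obtain ⟨n, f, κ, h1, h2⟩ := hW i i.2
    refine ⟨n, f, κ, h1, ?_⟩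
    rintro E rfl
    exact h2
  · intro σ hσ
    rcases σ.eq_empty_or_nonempty with rfl | hne
    · obtain ⟨n, f, κ, h1⟩ := h0
      exact ⟨n, f, κ, h1, by simp⟩
    · have h := hfl (Subtype.val '' σ) (Set.toFinite _) (hne.image _) ?_ ?_
      · obtain ⟨n, f, κ, h1, h2⟩ := simplex_CC h
        refine ⟨n, f, κ, h1, fun E hE => ?_⟩
        rw [h2]
        exact ⟨E, hE, rfl⟩
      · rintro _ ⟨E, hE, rfl⟩
        obtain ⟨n, f, κ, h1, h2⟩ := hW E E.2
        exact edge_of_singleton (h1.sub_simplex ⟨_, rfl⟩ (by simpa using h2))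
      · rintro _ ⟨E, hE, rfl⟩ _ ⟨F, hF, rfl⟩ _
        obtain ⟨n, f, κ, h1, h2⟩ := hσ E hE F hF
        apply h1.sub_simplex ⟨_, Or.inl rfl⟩
        rintro G (rfl | rfl)
        · exact h2 E (Or.inl rfl)
        · exact h2 F (Or.inr rfl)

end Loc
end GLC


namespace GLC

section Fin
variable {X : Type*} [MetricSpace X]

theorem near_corner (C : CubeComplex X) (x : X) : ∃ (v : X) (u : Set X → ℝ), C.IsVertex v ∧
    (∃ (n : ℕ) (f : Eu n → X) (κ : Eu n), CC C v f κ) ∧ Rel C v x u ∧ ∀ E, u E ≤ 1 / 2 := by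
  classical
  obtain ⟨⟨n, f⟩, hc, p, hp, hpx⟩ := C.cover x
  change p ∈ unitCube n at hp
  change f p = x at hpx
  let κ : Eu n := WithLp.toLp 2 fun i => if p i ≤ 1 / 2 then 0 else 1
  have hκi : ∀ i, κ i = if p i ≤ 1 / 2 then 0 else 1 := fun i => rfl
  have hκ : κ ∈ cubeCorners n := by
    intro i; rw [hκi]; split_ifs <;> simp
  have hcc : CC C (f κ) f κ := ⟨hc, hκ, rfl⟩
  refine ⟨f κ, crd f κ p, hcc.isVertex, ⟨n, f, κ, hcc⟩, ⟨n, f, κ, hcc, p, hp, hpx, rfl⟩, ?_⟩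
  intro E
  by_cases hE : E ∈ Set.range (cornerEdge f κ)
  · obtain ⟨i, rfl⟩ := hE
    rw [hcc.crd_edge, hκi, abs_le]
    have := hp i
    split_ifs with h <;> constructor <;> linarith [this.1, this.2]
  · rw [crd_ne _ _ _ hE]; norm_num

theorem cat0_of_flag (C : CubeComplex X) (h : ∀ v : X, C.IsVertex v → C.LinkFlag v) :
    NonPositivelyCurved X := by
  classical
  intro x0
  obtain ⟨v, u0, hv, h0, hr0, hu0⟩ := near_corner C x0
  have hfl := h v hv
  refine ⟨1 / 8, by norm_num, ?_⟩
  have hR : ∀ y : Metric.ball x0 (1 / 8 : ℝ), ∃ u, Rel C v y u ∧ ∀ E, u E ≤ 5 / 8 := by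
    intro y
    have hy : dist x0 y < 1 / 8 := by rw [dist_comm]; exact y.2
    obtain ⟨u, h1, h2⟩ := near hr0 (fun E => by linarith [hu0 E]) hy
    exact ⟨u, h1, fun E => by linarith [h2 E, hu0 E]⟩
  choose U hU hU' using hR
  choose T hT hT' using fun y => (hU y).supp
  let b0 : Metric.ball x0 (1 / 8 : ℝ) := ⟨x0, Metric.mem_ball_self (by norm_num)⟩
  have hdist : ∀ x y : Metric.ball x0 (1 / 8 : ℝ), dist x y < 3 / 8 := by
    intro x y
    have h1 : dist (x : X) x0 < 1 / 8 := x.2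
    have h2 : dist (y : X) x0 < 1 / 8 := y.2
    have := dist_triangle_right (x : X) y x0
    rw [Subtype.dist_eq]; linarith
  have isoB : ∀ (W : Finset (Set X)) (a b : Orth (KW C v W)) (x y : Metric.ball x0 (1 / 8 : ℝ)),
      Rel C v x (ex W a.val) → Rel C v y (ex W b.val) → dist a b = dist x y := by
    intro W a b x y hx hy
    refine iso (c := 3 / 8) hx hy ?_ (hdist x y)
    intro E
    rw [hx.fn (hU x)]
    linarith [hU' x E]
  have ptR : ∀ (W : Finset (Set X)) (x : Metric.ball x0 (1 / 8 : ℝ)), T x ⊆ W →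
      Rel C v x (ex W ((hU x).pt W).val) := by
    intro W x hx
    rw [(hU x).pt_val fun E hE => hx (hT' x E hE)]
    exact hU x
  constructor
  · intro y z
    set W : Finset (Set X) := T b0 ∪ T y ∪ T z with hW
    have hWE : ∀ E ∈ W, IsE C v E := by
      intro E hE
      rw [hW, Finset.mem_union, Finset.mem_union] at hE
      rcases hE with (hE | hE) | hE
      · exact hT _ E hE
      · exact hT _ E hE
      · exact hT _ E hE
    have hC := isC_KW hfl hWE h0
    have r0 := ptR W b0 (by intro E hE; simp [hW, hE])
    have ry := ptR W y (by intro E hE; simp [hW, hE])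
    have rz := ptR W z (by intro E hE; simp [hW, hE])
    set a0 := (hU b0).pt W
    set a := (hU y).pt W
    set b := (hU z).pt W
    have dab : dist a b = dist y z := isoB W a b y z ry rz
    have d0a : dist a0 a < 1 / 8 := by
      rw [isoB W a0 a b0 y r0 ry, dist_comm]; exact y.2
    have d0b : dist a0 b < 1 / 8 := by
      rw [isoB W a0 b b0 z r0 rz, dist_comm]; exact z.2
    obtain ⟨γ, g0, g1, g2, g3⟩ := hC.geodesic a b
    have hl : ∀ s : ℝ, ∃ w : Metric.ball x0 (1 / 8 : ℝ), s ∈ Set.Icc (0 : ℝ) (dist a b) →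
        Rel C v w (ex W (γ s).val) := by
      intro s
      by_cases hs : s ∈ Set.Icc (0 : ℝ) (dist a b)
      · obtain ⟨k1, k2⟩ := g2 s hs
        have hd : dist a0 (γ s) < 1 / 8 := by
          have hst := hC.st a0 trivial a trivial b trivial (γ s) trivial (by rw [k1, k2]; ring)
          rw [k1, k2] at hst
          rcases eq_or_lt_of_le (dist_nonneg (x := a) (y := b)) with hD | hD
          · rw [← hD] at hs
            have : s = 0 := le_antisymm hs.2 hs.1
            rw [this, g0]; exact d0a
          · by_contra hcon
            push Not at hcon
            have n0 := dist_nonneg (x := a0) (y := a)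
            have n1 := dist_nonneg (x := a0) (y := b)
            have q0 : dist a0 a ^ 2 < (1 / 8) ^ 2 := pow_lt_pow_left₀ d0a n0 (by norm_num)
            have q1 : dist a0 b ^ 2 < (1 / 8) ^ 2 := pow_lt_pow_left₀ d0b n1 (by norm_num)
            have q2 : (1 / 8 : ℝ) ^ 2 ≤ dist a0 (γ s) ^ 2 :=
              pow_le_pow_left₀ (by norm_num) hcon 2
            have w1 : dist a b * (1 / 8 : ℝ) ^ 2 ≤ dist a b * dist a0 (γ s) ^ 2 :=
              mul_le_mul_of_nonneg_left q2 hD.le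
            have w2 : (dist a b - s) * dist a0 a ^ 2 ≤ (dist a b - s) * (1 / 8) ^ 2 :=
              mul_le_mul_of_nonneg_left q0.le (by linarith [hs.2])
            have w3 : s * dist a0 b ^ 2 ≤ s * (1 / 8) ^ 2 :=
              mul_le_mul_of_nonneg_left q1.le hs.1
            have w4 : 0 ≤ s * (dist a b - s) * dist a b :=
              mul_nonneg (mul_nonneg hs.1 (by linarith [hs.2])) hD.le
            rcases eq_or_lt_of_le hs.1 with hs0 | hs0
            · rw [← hs0, g0] at hcon; linarith
            · have w5 : s * dist a0 b ^ 2 < s * (1 / 8) ^ 2 :=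
                mul_lt_mul_of_pos_left q1 hs0
              nlinarith
        obtain ⟨w, hw, hw'⟩ := lift_pt (c := 1 / 8) r0 (fun E => by
          rw [r0.fn (hU b0)]; linarith [hU' b0 E]) hd
        refine ⟨⟨w, ?_⟩, fun _ => hw⟩
        rw [Metric.mem_ball, dist_comm]
        exact hw'.trans_lt hd
      · exact ⟨b0, fun h => absurd h hs⟩
    choose Γ hΓ using hl
    refine ⟨Γ, ?_, ?_, ?_⟩
    · have := hΓ 0 ⟨le_rfl, dist_nonneg⟩
      rw [g0] at this
      exact Subtype.ext (this.inj ry)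
    · have := hΓ (dist a b) ⟨dist_nonneg, le_rfl⟩
      rw [g1] at this
      rw [← dab]
      exact Subtype.ext (this.inj rz)
    · intro s hs t ht
      rw [← dab] at hs ht
      rw [← isoB W _ _ _ _ (hΓ s hs) (hΓ t ht)]
      exact g3 s hs t ht
  · intro p q r m hm
    set W : Finset (Set X) := T p ∪ T q ∪ T r ∪ T m with hW
    have hWE : ∀ E ∈ W, IsE C v E := by
      intro E hE
      rw [hW, Finset.mem_union, Finset.mem_union, Finset.mem_union] at hE
      rcases hE with ((hE | hE) | hE) | hE
      · exact hT _ E hE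
      · exact hT _ E hE
      · exact hT _ E hE
      · exact hT _ E hE
    have hC := isC_KW hfl hWE h0
    have rp := ptR W p (by intro E hE; simp [hW, hE])
    have rq := ptR W q (by intro E hE; simp [hW, hE])
    have rr := ptR W r (by intro E hE; simp [hW, hE])
    have rm := ptR W m (by intro E hE; simp [hW, hE])
    obtain ⟨m1, m2⟩ := hm
    rw [dist_comm] at m2
    rw [← isoB W _ _ _ _ rq rm, ← isoB W _ _ _ _ rq rr] at m1
    rw [← isoB W _ _ _ _ rm rr, ← isoB W _ _ _ _ rq rr] at m2
    rw [← isoB W _ _ _ _ rp rm, ← isoB W _ _ _ _ rp rq, ← isoB W _ _ _ _ rp rr,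
      ← isoB W _ _ _ _ rq rr]
    have := hC.stn (e := 1 / 2) (p := (hU p).pt W) (x := (hU q).pt W) (y := (hU r).pt W)
      (z := (hU m).pt W) trivial trivial trivial trivial (by rw [m1]; ring) (by rw [m2]; ring)
    linarith

theorem ex_zero (W : Finset (Set X)) : ex W 0 = fun _ => 0 := by
  ext E
  simp [ex]

theorem crd_self {n : ℕ} (f : Eu n → X) (κ : Eu n) : crd f κ κ = fun _ => 0 := by
  ext E
  simp [crd]

/-- an empty simplex produces a bigon -/
theorem no_empty_simplex (C : CubeComplex X) (hN : NonPositivelyCurved X) (v : X)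
    (W : Finset (Set X)) (h3 : 3 ≤ W.card)
    (hsub : ∀ T : Set (Set X), T.Nonempty → T ⊂ (W : Set (Set X)) → T ∈ C.LinkSimplices v) :
    (W : Set (Set X)) ∈ C.LinkSimplices v := by
  classical
  by_contra hnot
  obtain ⟨e1, he1, e2, he2, e3, he3, h12, h13, h23⟩ := Finset.two_lt_card.1 h3
  have hs1 : ({e1} : Set (Set X)) ∈ C.LinkSimplices v := by
    apply hsub _ (Set.singleton_nonempty e1)
    rw [Set.ssubset_iff_of_subset (by simpa using he1)]
    exact ⟨e2, he2, fun h => h12 h.symm⟩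
  obtain ⟨n0, f0, κ0, hcc0, _⟩ := simplex_CC hs1
  have hK : ∀ σ, σ ∈ KW C v W ↔ σ ≠ Set.univ := by
    intro σ
    constructor
    · rintro ⟨n, f, κ, h1, h2⟩ rfl
      exact hnot (h1.sub_simplex ⟨e1, he1⟩ fun E hE => h2 ⟨E, hE⟩ trivial)
    · intro hσ
      rcases σ.eq_empty_or_nonempty with rfl | hne
      · exact ⟨n0, f0, κ0, hcc0, by simp⟩
      · have : Subtype.val '' σ ∈ C.LinkSimplices v := by
          apply hsub _ (hne.image _)
          rw [Set.ssubset_iff_of_subset (by rintro _ ⟨E, _, rfl⟩; exact E.2)]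
          obtain ⟨E, hE⟩ := (Set.ne_univ_iff_exists_notMem σ).1 hσ
          refine ⟨E, E.2, ?_⟩
          rintro ⟨F, hF, hFE⟩
          rw [Subtype.ext hFE] at hF
          exact hE hF
        obtain ⟨n, f, κ, h1, h2⟩ := simplex_CC this
        refine ⟨n, f, κ, h1, fun E hE => ?_⟩
        rw [h2]; exact ⟨E, hE, rfl⟩
  obtain ⟨ε, hε, hcat⟩ := hN v
  set η : ℝ := min (ε / 2) (1 / 8) with hη
  have hη0 : 0 < η := lt_min (by linarith) (by norm_num)
  have hη1 : η ≤ 1 / 8 := min_le_right _ _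
  have hη2 : η < ε := (min_le_left _ _).trans_lt (by linarith)
  obtain ⟨q, p, a, b, nq, np, na, nb, hab, d1, d2, d3, d4⟩ := bigon hK
    (i1 := ⟨e1, he1⟩) (i2 := ⟨e2, he2⟩) (i3 := ⟨e3, he3⟩)
    (fun h => h12 (congrArg Subtype.val h).symm) (fun h => h13 (congrArg Subtype.val h).symm)
    (fun h => h23 (congrArg Subtype.val h)) hη0
  have hsp0 : sp (0 : EuclideanSpace ℝ W) = ∅ := by simp [sp]
  let o : Orth (KW C v W) := ⟨0, fun _ => le_rfl, by
    rw [hsp0]; exact ⟨n0, f0, κ0, hcc0, by simp⟩⟩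
  have ro : Rel C v v (ex W o.val) := by
    refine ⟨n0, f0, κ0, hcc0, κ0, corner_cube hcc0.cor, hcc0.eq, ?_⟩
    rw [crd_self]; exact (ex_zero W).symm
  have lift : ∀ x : Orth (KW C v W), ‖x.val‖ ≤ η →
      ∃ z : Metric.ball v ε, Rel C v z (ex W x.val) ∧ dist v z ≤ 1 / 8 := by
    intro x hx
    have hd : dist o x = ‖x.val‖ := by
      rw [Orth.dist_eq_of_step ⟨o.nonneg, x.nonneg, _, x.mem, ?_, le_rfl⟩]
      · exact dist_zero_left _
      · change sp (0 : EuclideanSpace ℝ W) ⊆ _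
        rw [hsp0]; exact Set.empty_subset _
    obtain ⟨z, hz, hz'⟩ := lift_pt (b := x) (c := 1) ro (fun E => by
      change ex W 0 E + 1 ≤ 1; rw [ex_zero]; simp) (by rw [hd]; linarith)
    rw [hd] at hz'
    exact ⟨⟨z, by rw [Metric.mem_ball, dist_comm]; linarith⟩, hz, by
      change dist v z ≤ _; linarith⟩
  have isoB : ∀ (x y : Orth (KW C v W)) (x' y' : Metric.ball v ε), ‖x.val‖ ≤ η →
      Rel C v x' (ex W x.val) → Rel C v y' (ex W y.val) →
      dist v x' ≤ 1 / 8 → dist v y' ≤ 1 / 8 → dist x y = dist x' y' := by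
    intro x y x' y' hx hx' hy' hd hd'
    refine iso (c := 1 / 2) hx' hy' ?_ ?_
    · intro E
      have : ex W x.val E ≤ 1 / 8 := by
        refine ex_le (by norm_num) (fun F => ?_) E
        have := PiLp.norm_apply_le x.val F
        have := le_abs_self (x.val F)
        rw [← Real.norm_eq_abs] at this
        linarith
      linarith
    · have := dist_triangle_left (x' : X) y' v
      linarith
  obtain ⟨q', rq, eq⟩ := lift q nq
  obtain ⟨p', rp, ep⟩ := lift p np
  obtain ⟨a', ra, ea⟩ := lift a na
  obtain ⟨b', rb, eb⟩ := lift b nb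
  rw [isoB _ _ _ _ nq rq ra eq ea, isoB _ _ _ _ nq rq rp eq ep] at d1
  rw [isoB _ _ _ _ np rp ra ep ea, isoB _ _ _ _ nq rq rp eq ep] at d2
  rw [isoB _ _ _ _ nq rq rb eq eb, isoB _ _ _ _ nq rq rp eq ep] at d3
  rw [isoB _ _ _ _ np rp rb ep eb, isoB _ _ _ _ nq rq rp eq ep] at d4
  have hcn := hcat.2 a' q' p' b' ⟨d3, d4⟩
  rw [dist_comm a' q', dist_comm a' p', d1, d2] at hcn
  have h0 : dist a' b' ^ 2 ≤ 0 := by linarith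
  have h1 : dist a' b' = 0 := by nlinarith [dist_nonneg (x := a') (y := b')]
  have h2 := dist_eq_zero.1 h1
  rw [← h2] at rb
  have h4 := ra.fn rb
  apply hab
  apply Orth.ext'
  rw [← res_ex a.val, h4, res_ex]

theorem flag_of_cat0 (C : CubeComplex X) (hN : NonPositivelyCurved X) (v : X) : C.LinkFlag v := by
  classical
  intro S hfin
  obtain ⟨W, rfl⟩ := hfin.exists_finset_coe
  clear hfin
  induction W using Finset.strongInduction with
  | H W ih =>
    intro hne hE hp
    rcases Nat.lt_or_ge W.card 3 with hlt | hge
    · have hpos : 0 < W.card := Finset.card_pos.2 (by simpa using hne)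
      have h12 : W.card = 1 ∨ W.card = 2 := by omega
      rcases h12 with h1 | h2
      · obtain ⟨E, rfl⟩ := Finset.card_eq_one.1 h1
        rw [Finset.coe_singleton]
        exact singleton_of_edge (hE (by simp))
      · obtain ⟨E, F, hEF, rfl⟩ := Finset.card_eq_two.1 h2
        rw [Finset.coe_pair]
        exact hp E (by simp) F (by simp) hEF
    · apply no_empty_simplex C hN v W hge
      intro T hT hTW
      obtain ⟨T', rfl⟩ := (W.finite_toSet.subset hTW.subset).exists_finset_coe
      refine ih T' (Finset.coe_ssubset.1 hTW) hT (hTW.subset.trans hE) ?_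
      exact fun a ha b hb => hp a (hTW.subset ha) b (hTW.subset hb)

end Fin
end GLC

/-- Gromov's Link Condition: a finite-dimensional cube complex is
non-positively curved (locally CAT(0)) if and only if the link of every vertex
is a flag simplicial complex. -/
theorem gromov_link_condition {X : Type*} [MetricSpace X] (C : CubeComplex X)
    (hfd : ∃ N : ℕ, ∀ c ∈ C.charts, c.1 ≤ N) :
    NonPositivelyCurved X ↔ ∀ v : X, C.IsVertex v → C.LinkFlag v := by
  exact ⟨fun h v _ => GLC.flag_of_cat0 C h v, fun h => GLC.cat0_of_flag C h⟩

end
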